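/- Let $X$ be a connected locally finite graph with infinitely many ends, and let $G \le \mathrm{Aut}(X)$ be a closed subgroup (in the permutation topology) that is non-compact and acts transitively on the boundary (space of ends) of $X$. Then $G$ is not a Wiener group. -/

import Mathlib

open scoped ENNReal

noncomputable section

namespace GraphWiener

/-! ### The Wiener property for a locally compact group -/

variable {G : Type} [Group G] [TopologicalSpace G] [MeasurableSpace G]

/-- Convolution of two complex-valued functions on a locally compact group, with respect to a
(left Haar) measure `μ`. -/
def conv (μ : MeasureTheory.Measure G) (f g : G → ℂ) : G → ℂ :=
  fun x => ∫ y, f y * g (y⁻¹ * x) ∂μ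

/-- The involution `f^*(x) = conj (f (x⁻¹))` on functions on a (unimodular) group. -/
def starFun (f : G → ℂ) : G → ℂ := fun x => (starRingEnd ℂ) (f x⁻¹)

/-- A proper closed two-sided ideal of `L¹(G)`, described at the level of integrable
functions: a two-sided ideal for convolution, closed in the `L¹`-norm. -/
structure IsClosedIdealL1 (μ : MeasureTheory.Measure G) (I : Set (G → ℂ)) : Prop where
  subset_L1 : ∀ f ∈ I, MeasureTheory.Integrable f μ
  zero_mem : (fun _ => (0 : ℂ)) ∈ I
  add_mem : ∀ f ∈ I, ∀ g ∈ I, f + g ∈ I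
  smul_mem : ∀ (c : ℂ), ∀ f ∈ I, c • f ∈ I
  conv_mem_left : ∀ f : G → ℂ, MeasureTheory.Integrable f μ → ∀ g ∈ I, conv μ f g ∈ I
  conv_mem_right : ∀ g ∈ I, ∀ f : G → ℂ, MeasureTheory.Integrable f μ → conv μ g f ∈ I
  ae_mem : ∀ f ∈ I, ∀ g : G → ℂ, MeasureTheory.Integrable g μ → f =ᵐ[μ] g → g ∈ I
  closed : ∀ f : G → ℂ, MeasureTheory.Integrable f μ →
    (∀ ε : ℝ≥0∞, 0 < ε → ∃ g ∈ I, MeasureTheory.eLpNorm (f - g) 1 μ < ε) → f ∈ I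

/-- A topologically irreducible non-degenerate `*`-representation of `L¹(G)` on a non-zero
Hilbert space, described at the level of integrable functions. -/
structure L1StarRep (μ : MeasureTheory.Measure G) where
  /-- the underlying Hilbert space -/
  H : Type
  [instNACG : NormedAddCommGroup H]
  [instIPS : InnerProductSpace ℂ H]
  [instCS : CompleteSpace H]
  [instNT : Nontrivial H]
  /-- the representation map -/
  π : (G → ℂ) → (H →L[ℂ] H)
  map_add : ∀ f g : G → ℂ, MeasureTheory.Integrable f μ → MeasureTheory.Integrable g μ →
    π (f + g) = π f + π g
  map_smul : ∀ (c : ℂ) (f : G → ℂ), MeasureTheory.Integrable f μ → π (c • f) = c • π f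
  map_conv : ∀ f g : G → ℂ, MeasureTheory.Integrable f μ → MeasureTheory.Integrable g μ →
    π (conv μ f g) = (π f).comp (π g)
  map_star : ∀ f : G → ℂ, MeasureTheory.Integrable f μ →
    π (starFun f) = ContinuousLinearMap.adjoint (π f)
  norm_le : ∀ f : G → ℂ, MeasureTheory.Integrable f μ →
    ‖π f‖ ≤ (MeasureTheory.eLpNorm f 1 μ).toReal
  congr_ae : ∀ f g : G → ℂ, MeasureTheory.Integrable f μ → MeasureTheory.Integrable g μ →
    f =ᵐ[μ] g → π f = π g

attribute [instance] L1StarRep.instNACG L1StarRep.instIPS L1StarRep.instCS L1StarRep.instNT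

/-- Topological irreducibility of a representation of `L¹(G)`. -/
def L1StarRep.TopIrred {μ : MeasureTheory.Measure G} (ρ : L1StarRep μ) : Prop :=
  ∀ W : Submodule ℂ ρ.H, IsClosed (W : Set ρ.H) →
    (∀ f : G → ℂ, MeasureTheory.Integrable f μ → ∀ v ∈ W, ρ.π f v ∈ W) → W = ⊥ ∨ W = ⊤

/-- Non-degeneracy of a representation of `L¹(G)`. -/
def L1StarRep.Nondegenerate {μ : MeasureTheory.Measure G} (ρ : L1StarRep μ) : Prop :=
  Dense (↑(Submodule.span ℂ {x : ρ.H | ∃ (f : G → ℂ) (v : ρ.H),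
    MeasureTheory.Integrable f μ ∧ x = ρ.π f v}) : Set ρ.H)

/-- `G` (with left Haar measure `μ`) is a Wiener group: every proper closed two-sided ideal
of `L¹(G)` is contained in the kernel of a topologically irreducible non-degenerate
`*`-representation of `L¹(G)`. -/
def IsWienerGroup (μ : MeasureTheory.Measure G) : Prop :=
  ∀ I : Set (G → ℂ), IsClosedIdealL1 μ I →
    (∃ f : G → ℂ, MeasureTheory.Integrable f μ ∧ f ∉ I) →
    ∃ ρ : L1StarRep μ, ρ.TopIrred ∧ ρ.Nondegenerate ∧ ∀ f ∈ I, ρ.π f = 0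


/-! ### Graphs, the permutation topology and ends -/

/-- The permutation topology on `Equiv.Perm V`: the topology induced by pointwise convergence
of a permutation together with its inverse (`V` being discrete). -/
instance permTopology (V : Type) : TopologicalSpace (Equiv.Perm V) :=
  letI : TopologicalSpace V := ⊥
  TopologicalSpace.induced (fun φ : Equiv.Perm V => (⇑φ, ⇑φ.symm)) inferInstance

/-- `φ` maps the end `s` of the graph `X` to the end `t`: for every finite `K ⊆ V`, `t`
assigns to `K` the component of the complement of `K` containing the `φ`-image of the
component that `s` assigns to `φ⁻¹(K)`. This is the natural action of automorphisms on the
space of ends. -/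
def EndMapsTo {V : Type} [DecidableEq V] (X : SimpleGraph V) (φ : Equiv.Perm V)
    (s t : ∀ j : (Finset V)ᵒᵖ, X.componentComplFunctor.obj j) : Prop :=
  ∀ (K : Finset V) (v : V), v ∈ (s (Opposite.op (K.image ⇑φ.symm))).supp →
    ∀ hv : φ v ∉ (K : Set V), t (Opposite.op K) = X.componentComplMk hv

end GraphWiener

open MeasureTheory Filter Topology

namespace GraphWiener

set_option linter.unusedSectionVars false

section Kernel

variable {G : Type} [Group G] [TopologicalSpace G] [IsTopologicalGroup G]
  [SecondCountableTopology G] [MeasurableSpace G] [BorelSpace G]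
  (μ : Measure G)

/-- The kernel obtained by integrating `f` against the two-sided translates of `φ`. -/
def kerInt (φ f : G → ℂ) (x y : G) : ℂ := ∫ g, f g * φ (x * g * y) ∂μ

variable {μ}

lemma integrable_mul_translate {φ : G → ℂ} {C : ℝ} (hφ : Continuous φ) (hC : ∀ x, ‖φ x‖ ≤ C)
    {f : G → ℂ} (hf : Integrable f μ) (x y : G) :
    Integrable (fun g => f g * φ (x * g * y)) μ :=
  hf.mul_bdd (c := C) ((hφ.comp (by fun_prop)).aestronglyMeasurable)
    (Eventually.of_forall fun _ => hC _)

lemma integrable_conv_prod [SFinite μ] [μ.IsMulLeftInvariant] {f g : G → ℂ}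
    (hf : Integrable f μ) (hg : Integrable g μ) :
    Integrable (fun p : G × G => f p.1 * g (p.1⁻¹ * p.2)) (μ.prod μ) := by
  have h := (measurePreserving_prod_inv_mul μ μ).integrable_comp_of_integrable
    (hf.mul_prod hg)
  exact h

lemma integrable_conv [SFinite μ] [μ.IsMulLeftInvariant] {f g : G → ℂ}
    (hf : Integrable f μ) (hg : Integrable g μ) : Integrable (conv μ f g) μ :=
  (integrable_conv_prod hf hg).integral_prod_right

lemma kerInt_conv [SFinite μ] [μ.IsMulLeftInvariant] {φ : G → ℂ} {C : ℝ} (hφ : Continuous φ)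
    (hC : ∀ x, ‖φ x‖ ≤ C) {f g : G → ℂ} (hf : Integrable f μ) (hg : Integrable g μ) (x y : G) :
    kerInt μ φ (conv μ f g) x y = ∫ k, f k * kerInt μ φ g (x * k) y ∂μ := by
  have h1 : Integrable (fun p : G × G => f p.1 * g (p.1⁻¹ * p.2) * φ (x * p.2 * y))
      (μ.prod μ) :=
    (integrable_conv_prod hf hg).mul_bdd (c := C)
      ((hφ.comp (by fun_prop)).aestronglyMeasurable) (Eventually.of_forall fun _ => hC _)
  simp only [kerInt, conv]
  simp_rw [← integral_mul_const]
  rw [integral_integral_swap (f := fun z k => f k * g (k⁻¹ * z) * φ (x * z * y)) h1.swap]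
  congr 1
  ext k
  rw [← integral_const_mul, ← integral_mul_left_eq_self _ k]
  congr 1
  ext z
  simp [mul_assoc]

lemma integrable_prod_kernel [SFinite μ] {φ : G → ℂ} {C : ℝ} (hφ : Continuous φ)
    (hC : ∀ x, ‖φ x‖ ≤ C) {f g : G → ℂ} (hf : Integrable f μ) (hg : Integrable g μ)
    (x y z : G) :
    Integrable (fun p : G × G => f p.1 * (g p.2 * φ (x * p.1 * y * p.2 * z))) (μ.prod μ) := by
  have := (hf.mul_prod hg).mul_bdd (c := C) (g := fun p : G × G => φ (x * p.1 * y * p.2 * z))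
    ((hφ.comp (by fun_prop)).aestronglyMeasurable) (Eventually.of_forall fun _ => hC _)
  simpa only [mul_assoc] using this

lemma integral_kernel_swap [SFinite μ] {φ : G → ℂ} {C : ℝ} (hφ : Continuous φ)
    (hC : ∀ x, ‖φ x‖ ≤ C) {f g : G → ℂ} (hf : Integrable f μ) (hg : Integrable g μ)
    (x y z : G) :
    ∫ k, f k * kerInt μ φ g (x * k * y) z ∂μ = ∫ l, g l * kerInt μ φ f x (y * l * z) ∂μ := by
  simp only [kerInt]
  simp_rw [← integral_const_mul]
  rw [integral_integral_swap (integrable_prod_kernel hφ hC hf hg x y z)]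
  congr 1
  ext l
  congr 1
  ext k
  simp only [mul_assoc]
  ring

lemma kerInt_conv' [SFinite μ] [μ.IsMulLeftInvariant] {φ : G → ℂ} {C : ℝ} (hφ : Continuous φ)
    (hC : ∀ x, ‖φ x‖ ≤ C) {f g : G → ℂ} (hf : Integrable f μ) (hg : Integrable g μ) (x y : G) :
    kerInt μ φ (conv μ f g) x y = ∫ l, g l * kerInt μ φ f x (l * y) ∂μ := by
  rw [kerInt_conv hφ hC hf hg]
  simpa using integral_kernel_swap hφ hC hf hg x 1 y

lemma kerInt_add {φ : G → ℂ} {C : ℝ} (hφ : Continuous φ) (hC : ∀ x, ‖φ x‖ ≤ C) {f g : G → ℂ}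
    (hf : Integrable f μ) (hg : Integrable g μ) (x y : G) :
    kerInt μ φ (f + g) x y = kerInt μ φ f x y + kerInt μ φ g x y := by
  simp only [kerInt, Pi.add_apply, add_mul]
  exact integral_add (integrable_mul_translate hφ hC hf x y)
    (integrable_mul_translate hφ hC hg x y)

lemma kerInt_smul {φ : G → ℂ} (c : ℂ) (f : G → ℂ) (x y : G) :
    kerInt μ φ (c • f) x y = c * kerInt μ φ f x y := by
  simp only [kerInt, Pi.smul_apply, smul_eq_mul, mul_assoc]
  exact integral_const_mul _ _

lemma norm_kerInt_le {φ : G → ℂ} {C : ℝ} (hC : ∀ x, ‖φ x‖ ≤ C) {f : G → ℂ}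
    (hf : Integrable f μ) (x y : G) :
    ‖kerInt μ φ f x y‖ ≤ C * (eLpNorm f 1 μ).toReal := by
  have h0 : (eLpNorm f 1 μ).toReal = ∫ g, ‖f g‖ ∂μ := by
    rw [eLpNorm_one_eq_lintegral_enorm, integral_norm_eq_lintegral_enorm hf.1]
  rw [h0, ← integral_const_mul]
  refine norm_integral_le_of_norm_le (hf.norm.const_mul C) (Eventually.of_forall fun g => ?_)
  rw [norm_mul, mul_comm]
  exact mul_le_mul_of_nonneg_right (hC _) (norm_nonneg _)

/-- The functions annihilating all two-sided translates of `φ`. -/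
def annihilator (μ : Measure G) (φ : G → ℂ) : Set (G → ℂ) :=
  {f | Integrable f μ ∧ ∀ x y, kerInt μ φ f x y = 0}

lemma isClosedIdealL1_annihilator [SFinite μ] [μ.IsMulLeftInvariant] {φ : G → ℂ} {C : ℝ}
    (hφ : Continuous φ) (hC : ∀ x, ‖φ x‖ ≤ C) : IsClosedIdealL1 μ (annihilator μ φ) where
  subset_L1 f hf := hf.1
  zero_mem := ⟨integrable_zero _ _ _, fun x y => by simp [kerInt]⟩
  add_mem f hf g hg := ⟨hf.1.add hg.1, fun x y => by
    rw [kerInt_add hφ hC hf.1 hg.1, hf.2, hg.2, add_zero]⟩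
  smul_mem c f hf := ⟨hf.1.smul c, fun x y => by rw [kerInt_smul, hf.2, mul_zero]⟩
  conv_mem_left f hf g hg := ⟨integrable_conv hf hg.1, fun x y => by
    rw [kerInt_conv hφ hC hf hg.1]; simp [hg.2]⟩
  conv_mem_right g hg f hf := ⟨integrable_conv hg.1 hf, fun x y => by
    rw [kerInt_conv' hφ hC hg.1 hf]; simp [hg.2]⟩
  ae_mem f hf g hg hfg := ⟨hg, fun x y => by
    rw [← hf.2 x y]
    refine integral_congr_ae ?_
    filter_upwards [hfg] with z hz
    rw [hz]⟩
  closed f hf hcl := ⟨hf, fun x y => by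
    by_contra hne
    have hpos : 0 < ‖kerInt μ φ f x y‖ := norm_pos_iff.2 hne
    have hC0 : 0 ≤ C := (norm_nonneg _).trans (hC 1)
    obtain ⟨g, hg, hlt⟩ := hcl (ENNReal.ofReal (‖kerInt μ φ f x y‖ / (C + 1)))
      (by rw [ENNReal.ofReal_pos]; positivity)
    have h1 : kerInt μ φ f x y = kerInt μ φ (f - g) x y := by
      have := kerInt_add hφ hC (hf.sub hg.1) hg.1 x y
      rw [sub_add_cancel, hg.2, add_zero] at this
      exact this
    have h2 := norm_kerInt_le hC (hf.sub hg.1) x y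
    rw [← h1] at h2
    have h3 : (eLpNorm (f - g) 1 μ).toReal < ‖kerInt μ φ f x y‖ / (C + 1) :=
      (ENNReal.lt_ofReal_iff_toReal_lt hlt.ne_top).1 hlt
    rw [lt_div_iff₀ (by positivity)] at h3
    have h4 : 0 ≤ (eLpNorm (f - g) 1 μ).toReal := ENNReal.toReal_nonneg
    nlinarith⟩

end Kernel

section Skeleton

lemma exists_finset_span_image {ι E : Type*} [AddCommGroup E] [Module ℂ E] (u : ι → E)
    (h : (Submodule.span ℂ (Set.range u)).FG) :
    ∃ t : Finset ι, ∀ i, u i ∈ Submodule.span ℂ (u '' t) := by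
  classical
  obtain ⟨s, hs, hspan⟩ := (Submodule.fg_span_iff_fg_span_finset_subset _).1 h
  rw [← Set.image_univ, Finset.subset_set_image_iff] at hs
  obtain ⟨t, -, rfl⟩ := hs
  refine ⟨t, fun i => ?_⟩
  rw [Finset.coe_image] at hspan
  rw [← hspan]
  exact Submodule.subset_span ⟨i, rfl⟩

/-- A kernel of finite rank is determined by finitely many of its rows and columns. -/
lemma exists_skeleton {X Y : Type*} (k : X → Y → ℂ) (W : Submodule ℂ (X → ℂ))
    [FiniteDimensional ℂ W] (hk : ∀ y, (fun x => k x y) ∈ W) :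
    ∃ (s : Finset X) (t : Finset Y) (c : s → t → ℂ),
      ∀ x y, k x y = ∑ i, ∑ j, c i j * (k x j * k i y) := by
  classical
  obtain ⟨t, ht⟩ := exists_finset_span_image (fun y x => k x y) (by
    have hle : Submodule.span ℂ (Set.range fun y x => k x y) ≤ W :=
      Submodule.span_le.2 (by rintro _ ⟨y, rfl⟩; exact hk y)
    have := Submodule.finiteDimensional_of_le hle
    exact Module.Finite.iff_fg.1 this)
  let ev : X → Module.Dual ℂ W := fun x => (LinearMap.proj x).comp W.subtype
  obtain ⟨s, hs⟩ := exists_finset_span_image ev (IsNoetherian.noetherian _)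
  let R : W →ₗ[ℂ] (s → ℂ) := LinearMap.pi fun i => ev i
  have hR : LinearMap.ker R = ⊥ := by
    rw [LinearMap.ker_eq_bot']
    intro w hw
    ext x
    have h1 : Submodule.span ℂ (ev '' s) ≤ LinearMap.ker (LinearMap.applyₗ (R := ℂ) w) := by
      refine Submodule.span_le.2 ?_
      rintro _ ⟨i, hi, rfl⟩
      exact congrFun hw ⟨i, hi⟩
    exact h1 (hs x)
  obtain ⟨L, hL⟩ := R.exists_leftInverse_of_injective hR
  let T : Submodule ℂ (X → ℂ) := Submodule.span ℂ ((fun y x => k x y) '' t)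
  have hTW : T ≤ W := Submodule.span_le.2 (by rintro _ ⟨y, -, rfl⟩; exact hk y)
  let R' : T →ₗ[ℂ] (s → ℂ) := R.comp (Submodule.inclusion hTW)
  have hR' : LinearMap.ker R' = ⊥ := by
    rw [LinearMap.ker_eq_bot]
    exact (LinearMap.ker_eq_bot.1 hR).comp (Submodule.inclusion_injective hTW)
  obtain ⟨L', hL'⟩ := R'.exists_leftInverse_of_injective hR'
  have hc : ∀ i : s, ∃ c : t → ℂ,
      ∑ j, c j • (fun x => k x j) = (L' (Pi.single i 1) : X → ℂ) := by
    intro i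
    have := (L' (Pi.single i 1)).2
    have himg : ((fun y x => k x y) '' (t : Set Y))
        = Set.range (fun j : t => (fun x => k x j)) := by
      ext; simp
    change _ ∈ Submodule.span ℂ _ at this
    rw [himg, Submodule.mem_span_range_iff_exists_fun] at this
    exact this
  choose c hc using hc
  refine ⟨s, t, c, fun x y => ?_⟩
  let w : T := ⟨fun x => k x y, ht y⟩
  have h1 : w = L' (R' w) := by
    rw [← LinearMap.comp_apply, hL', LinearMap.id_apply]
  have h2 : R' w = ∑ i : s, k i y • Pi.single i (1 : ℂ) := by
    ext i
    simp [Finset.sum_apply, Pi.single_apply]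
    rfl
  have h3 : (fun x => k x y) = ∑ i : s, k i y • ((L' (Pi.single i 1) : T) : X → ℂ) := by
    have := congrArg (fun w : T => (w : X → ℂ)) h1
    rw [h2] at this
    simpa using this
  have h4 := congrFun h3 x
  simp only [Finset.sum_apply, Pi.smul_apply, smul_eq_mul] at h4
  rw [h4]
  refine Finset.sum_congr rfl fun i _ => ?_
  rw [← hc i]
  simp only [Finset.sum_apply, Pi.smul_apply, smul_eq_mul, Finset.mul_sum]
  refine Finset.sum_congr rfl fun j _ => ?_
  ring

/-- A linear map vanishing where a finite-dimensional linear map vanishes carries convergence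
of the latter to convergence of the former. -/
lemma tendsto_of_ker_le {E F κ : Type*} [AddCommGroup E] [Module ℂ E] [NormedAddCommGroup F]
    [NormedSpace ℂ F] [Fintype κ] (T : E →ₗ[ℂ] (κ → ℂ)) (ρ : E →ₗ[ℂ] F)
    (hker : ∀ b, T b = 0 → ρ b = 0) (b : ℕ → E) (M : κ → ℂ)
    (hb : Tendsto (fun n => T (b n)) atTop (𝓝 M)) :
    ∃ r : E, T r = M ∧ Tendsto (fun n => ρ (b n)) atTop (𝓝 (ρ r)) := by
  obtain ⟨r, hr⟩ : M ∈ LinearMap.range T :=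
    (Submodule.closed_of_finiteDimensional (LinearMap.range T)).mem_of_tendsto hb
      (Eventually.of_forall fun n => ⟨b n, rfl⟩)
  obtain ⟨S, hS⟩ := T.rangeRestrict.exists_rightInverse_of_surjective T.range_rangeRestrict
  let L : LinearMap.range T →ₗ[ℂ] F := ρ.comp S
  have hL : ∀ e, ρ e = L (T.rangeRestrict e) := by
    intro e
    have h0 : T (e - S (T.rangeRestrict e)) = 0 := by
      have h1 : T.rangeRestrict (S (T.rangeRestrict e)) = T.rangeRestrict e := by
        rw [← LinearMap.comp_apply, hS, LinearMap.id_apply]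
      have h2 : T (S (T.rangeRestrict e)) = T e := congrArg Subtype.val h1
      rw [map_sub, h2, sub_self]
    have h3 := hker _ h0
    rw [map_sub, sub_eq_zero] at h3
    exact h3
  refine ⟨r, hr, ?_⟩
  simp_rw [hL]
  have hc : Continuous L := LinearMap.continuous_of_finiteDimensional L
  refine (hc.tendsto _).comp ?_
  rw [tendsto_subtype_rng]
  change Tendsto (fun n => T (b n)) atTop (𝓝 (T r))
  rwa [hr]

/-- If `wₙ` converges to a nonzero vector and `zⁿ wₙ*` converges with `1 ≤ |z|` then `z = 1`. -/
lemma eq_one_of_tendsto_pow_smul {F : Type*} [NormedAddCommGroup F] [NormedSpace ℂ F]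
    {z : ℂ} (hz : 1 ≤ ‖z‖) {w : ℕ → F} {w₀ w₁ : F} (hw₀ : w₀ ≠ 0)
    (hw : Tendsto w atTop (𝓝 w₀)) (hzw : Tendsto (fun n => z ^ n • w n) atTop (𝓝 w₁)) :
    z = 1 := by
  have hw₁ : w₁ ≠ 0 := by
    rintro rfl
    have h1 : Tendsto (fun n => ‖z ^ n • w n‖) atTop (𝓝 0) := by simpa using hzw.norm
    have h2 : ‖w₀‖ ≤ 0 := le_of_tendsto_of_tendsto' hw.norm h1 fun n => by
      rw [norm_smul, norm_pow]
      exact le_mul_of_one_le_left (norm_nonneg _) (one_le_pow₀ hz)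
    exact hw₀ (norm_le_zero_iff.1 h2)
  have h1 : Tendsto (fun n => z • (z ^ n • w n)) atTop (𝓝 (z • w₁)) := hzw.const_smul z
  have hd : Tendsto (fun n => w (n + 1) - w n) atTop (𝓝 0) := by
    simpa using ((tendsto_add_atTop_iff_nat 1).2 hw).sub hw
  have hlim : ‖z‖ = 1 := by
    have hn : Tendsto (fun n => ‖z ^ n • w n‖ / ‖w n‖) atTop (𝓝 (‖w₁‖ / ‖w₀‖)) :=
      hzw.norm.div hw.norm (norm_ne_zero_iff.2 hw₀)
    have hn' : Tendsto (fun n => ‖z‖ ^ n) atTop (𝓝 (‖w₁‖ / ‖w₀‖)) := by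
      refine hn.congr' ?_
      filter_upwards [hw.eventually_ne hw₀] with n hn
      rw [norm_smul, norm_pow, mul_div_assoc, div_self (norm_ne_zero_iff.2 hn), mul_one]
    by_contra hne
    exact not_tendsto_nhds_of_tendsto_atTop
      (tendsto_pow_atTop_atTop_of_one_lt (lt_of_le_of_ne hz (Ne.symm hne))) _ hn'
  have h2 : Tendsto (fun n => z ^ (n + 1) • (w (n + 1) - w n)) atTop (𝓝 0) := by
    rw [tendsto_zero_iff_norm_tendsto_zero] at hd ⊢
    simpa [norm_smul, hlim] using hd
  have h3 : Tendsto (fun n => z ^ (n + 1) • w (n + 1)) atTop (𝓝 w₁) :=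
    (tendsto_add_atTop_iff_nat 1).2 hzw
  have h4 := (h3.sub h1).congr (f₂ := fun n => z ^ (n + 1) • (w (n + 1) - w n)) fun n => by
    rw [smul_sub, smul_smul z, pow_succ' z n]
  have h5 := tendsto_nhds_unique h4 h2
  have h6 : (1 - z) • w₁ = 0 := by rw [sub_smul, one_smul, h5]
  rcases smul_eq_zero.1 h6 with h7 | h7
  · exact (sub_eq_zero.1 h7).symm
  · exact absurd h7 hw₁

end Skeleton

section DoubleCoset

variable {G : Type} [Group G] [TopologicalSpace G] [IsTopologicalGroup G] [LocallyCompactSpace G]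
  [T2Space G] [SecondCountableTopology G] [MeasurableSpace G] [BorelSpace G]
  {μ : Measure G} [μ.IsHaarMeasure]

lemma integral_comp_mul_right (f : G → ℂ) (a : G) :
    ∫ x, f (x * a) ∂μ = (Measure.modularCharacterFun a : ℝ) • ∫ x, f x ∂μ := by
  have h := Measure.map_right_mul_eq_modularCharacterFun_smul μ a
  have h2 := integral_map_equiv (μ := μ) (MeasurableEquiv.mulRight a) f
  rw [MeasurableEquiv.coe_mulRight, h, integral_smul_nnreal_measure] at h2
  exact h2.symm

/-- The indicator function of a subgroup. -/
def subInd (V : Subgroup G) : G → ℂ := (V : Set G).indicator 1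

lemma subInd_inv (V : Subgroup G) (x : G) : subInd V x⁻¹ = subInd V x := by
  by_cases hx : x ∈ V <;> simp [subInd, hx]

lemma integrable_subInd {V : Subgroup G} (hVo : IsOpen (V : Set G)) (hVc : IsCompact (V : Set G)) :
    Integrable (subInd V) μ :=
  (integrable_indicator_iff hVo.measurableSet).2
    (integrableOn_const (hVc.measure_lt_top.ne))

lemma integral_subInd_mul {V : Subgroup G} (hVo : IsOpen (V : Set G)) (F : G → ℂ) :
    ∫ v, subInd V v * F v ∂μ = ∫ v in V, F v ∂μ := by
  rw [← integral_indicator hVo.measurableSet]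
  congr 1
  ext v
  by_cases hv : v ∈ (V : Set G) <;> simp [subInd, hv]

lemma kerInt_subInd {V : Subgroup G} (hVo : IsOpen (V : Set G)) (φ : G → ℂ) (x y : G) :
    kerInt μ φ (subInd V) x y = ∫ v in V, φ (x * v * y) ∂μ :=
  integral_subInd_mul hVo _

lemma kerInt_comp_mul_left (φ f : G → ℂ) (a x y : G) :
    kerInt μ φ (fun g => f (a⁻¹ * g)) x y = kerInt μ φ f (x * a) y := by
  simp only [kerInt]
  rw [← integral_mul_left_eq_self _ a]
  simp [mul_assoc]

lemma kerInt_comp_mul_right (φ f : G → ℂ) (a x y : G) :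
    kerInt μ φ (fun g => f (g * a⁻¹)) x y
      = (Measure.modularCharacterFun a⁻¹ : ℝ) • kerInt μ φ f x (a * y) := by
  simp only [kerInt]
  rw [← integral_comp_mul_right]
  simp [mul_assoc]

/-- The convolution of the indicators of a subgroup `V` and of its left translate `aV`. -/
def cosetConv (μ : Measure G) (V : Subgroup G) (a : G) : G → ℂ :=
  conv μ (subInd V) (fun x => subInd V (a⁻¹ * x))

variable {V : Subgroup G}

lemma integrable_cosetConv (hVo : IsOpen (V : Set G)) (hVc : IsCompact (V : Set G)) (a : G) :
    Integrable (cosetConv μ V a) μ :=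
  integrable_conv (integrable_subInd hVo hVc) ((integrable_subInd hVo hVc).comp_mul_left a⁻¹)

lemma starFun_cosetConv (a : G) :
    starFun (cosetConv μ V a) =
      ((Measure.modularCharacterFun a : ℝ) : ℂ) • cosetConv μ V a⁻¹ := by
  ext x
  have hreal : ∀ z : G, (starRingEnd ℂ) (subInd V z) = subInd V z := fun z => by
    by_cases hz : z ∈ V <;> simp [subInd, hz]
  simp only [starFun, cosetConv, conv, Pi.smul_apply]
  rw [← integral_conj]
  simp only [map_mul, hreal]
  rw [← integral_mul_left_eq_self _ x⁻¹]
  have h := integral_comp_mul_right (μ := μ)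
    (fun u => subInd V (x⁻¹ * u * a⁻¹) * subInd V u⁻¹) a
  simp only [mul_assoc, mul_inv_cancel, mul_one, mul_inv_rev, inv_inv] at h ⊢
  rw [smul_eq_mul, ← Complex.real_smul, h]
  congr 2
  ext u
  rw [subInd_inv, mul_comm]
  congr 1
  rw [← subInd_inv]
  simp [mul_assoc]

variable {φ : G → ℂ} {C : ℝ}

lemma kerInt_cosetConv (hVo : IsOpen (V : Set G)) (hVc : IsCompact (V : Set G))
    (hφ : Continuous φ) (hC : ∀ x, ‖φ x‖ ≤ C) (a s t : G) :
    kerInt μ φ (cosetConv μ V a) s t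
      = ∫ k, subInd V k * kerInt μ φ (subInd V) (s * k * a) t ∂μ := by
  rw [cosetConv, kerInt_conv hφ hC (integrable_subInd hVo hVc)
    ((integrable_subInd hVo hVc).comp_mul_left a⁻¹)]
  simp_rw [kerInt_comp_mul_left]

lemma kerInt_cosetConv' (hVo : IsOpen (V : Set G)) (hVc : IsCompact (V : Set G))
    (hφ : Continuous φ) (hC : ∀ x, ‖φ x‖ ≤ C) (a s t : G) :
    kerInt μ φ (cosetConv μ V a) s t
      = ∫ l, subInd V l * kerInt μ φ (subInd V) s (a * l * t) ∂μ := by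
  rw [kerInt_cosetConv hVo hVc hφ hC,
    integral_kernel_swap hφ hC (integrable_subInd hVo hVc) (integrable_subInd hVo hVc)]

lemma kerInt_cosetConv_eq (hVo : IsOpen (V : Set G)) (hVc : IsCompact (V : Set G))
    (hφ : Continuous φ) (hC : ∀ x, ‖φ x‖ ≤ C) (a s t : G) :
    kerInt μ φ (cosetConv μ V a) s t
      = ∫ k in V, ∫ g in V, φ (s * k * a * g * t) ∂μ ∂μ := by
  rw [kerInt_cosetConv hVo hVc hφ hC, integral_subInd_mul hVo]
  simp_rw [kerInt_subInd hVo]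

lemma continuous_kerInt_left (hφ : Continuous φ) (hC : ∀ x, ‖φ x‖ ≤ C) {f : G → ℂ} (hf : Integrable f μ) (y : G) :
    Continuous fun x => kerInt μ φ f x y := by
  refine continuous_of_dominated (bound := fun g => ‖f g‖ * C)
    (fun x => (integrable_mul_translate hφ hC hf x y).aestronglyMeasurable) (fun x => ?_)
    (hf.norm.mul_const C) ?_
  · exact Eventually.of_forall fun g => by
      rw [norm_mul]; exact mul_le_mul_of_nonneg_left (hC _) (norm_nonneg _)
  · exact Eventually.of_forall fun g => continuous_const.mul (hφ.comp (by fun_prop))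

lemma continuous_kerInt_right (hφ : Continuous φ) (hC : ∀ x, ‖φ x‖ ≤ C) {f : G → ℂ} (hf : Integrable f μ) (x : G) :
    Continuous fun y => kerInt μ φ f x y := by
  refine continuous_of_dominated (bound := fun g => ‖f g‖ * C)
    (fun y => (integrable_mul_translate hφ hC hf x y).aestronglyMeasurable) (fun x => ?_)
    (hf.norm.mul_const C) ?_
  · exact Eventually.of_forall fun g => by
      rw [norm_mul]; exact mul_le_mul_of_nonneg_left (hC _) (norm_nonneg _)
  · exact Eventually.of_forall fun g => continuous_const.mul (hφ.comp (by fun_prop))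

variable {s t : Finset G} {c : s → t → ℂ}

lemma kerInt_cosetConv_right (hVo : IsOpen (V : Set G)) (hVc : IsCompact (V : Set G))
    (hφ : Continuous φ) (hC : ∀ x, ‖φ x‖ ≤ C)
    (hk : ∀ x y, kerInt μ φ (subInd V) x y
      = ∑ i, ∑ j, c i j * (kerInt μ φ (subInd V) x j * kerInt μ φ (subInd V) i y))
    (a x y : G) :
    kerInt μ φ (cosetConv μ V a) x y = ∑ i, ∑ j, c i j *
      (kerInt μ φ (cosetConv μ V a) x j * kerInt μ φ (subInd V) i y) := by
  have hint : ∀ j : t, Integrable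
      (fun k => subInd V k * kerInt μ φ (subInd V) (x * k * a) j) μ := fun j =>
    (integrable_subInd hVo hVc).mul_bdd (c := C * (eLpNorm (subInd V) 1 μ).toReal)
      (((continuous_kerInt_left hφ hC (integrable_subInd hVo hVc) j).comp
        (by fun_prop : Continuous fun k => x * k * a)).aestronglyMeasurable)
      (Eventually.of_forall fun _ => norm_kerInt_le hC (integrable_subInd hVo hVc) _ _)
  simp_rw [kerInt_cosetConv hVo hVc hφ hC]
  simp_rw [← integral_mul_const, ← integral_const_mul]
  have h1 : ∀ i : s, ∀ j : t, Integrable (fun k => c i j *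
      (subInd V k * kerInt μ φ (subInd V) (x * k * a) j * kerInt μ φ (subInd V) i y)) μ :=
    fun i j => ((hint j).mul_const _).const_mul _
  simp_rw [← integral_finsetSum Finset.univ (fun j _ => h1 _ j)]
  rw [← integral_finsetSum Finset.univ
    (fun i _ => integrable_finsetSum Finset.univ fun j _ => h1 i j)]
  congr 1
  ext k
  rw [hk, Finset.mul_sum]
  refine Finset.sum_congr rfl fun i _ => ?_
  rw [Finset.mul_sum]
  refine Finset.sum_congr rfl fun j _ => ?_
  ring

lemma kerInt_cosetConv_left (hVo : IsOpen (V : Set G)) (hVc : IsCompact (V : Set G))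
    (hφ : Continuous φ) (hC : ∀ x, ‖φ x‖ ≤ C)
    (hk : ∀ x y, kerInt μ φ (subInd V) x y
      = ∑ i, ∑ j, c i j * (kerInt μ φ (subInd V) x j * kerInt μ φ (subInd V) i y))
    (a x y : G) :
    kerInt μ φ (cosetConv μ V a) x y = ∑ i, ∑ j, c i j *
      (kerInt μ φ (subInd V) x j * kerInt μ φ (cosetConv μ V a) i y) := by
  have hint : ∀ i : s, Integrable
      (fun k => subInd V k * kerInt μ φ (subInd V) i (a * k * y)) μ := fun i =>
    (integrable_subInd hVo hVc).mul_bdd (c := C * (eLpNorm (subInd V) 1 μ).toReal)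
      (((continuous_kerInt_right hφ hC (integrable_subInd hVo hVc) i).comp
        (by fun_prop : Continuous fun k => a * k * y)).aestronglyMeasurable)
      (Eventually.of_forall fun _ => norm_kerInt_le hC (integrable_subInd hVo hVc) _ _)
  simp_rw [kerInt_cosetConv' hVo hVc hφ hC]
  simp_rw [← integral_const_mul]
  have h1 : ∀ i : s, ∀ j : t, Integrable (fun k => c i j * (kerInt μ φ (subInd V) x j *
      (subInd V k * kerInt μ φ (subInd V) i (a * k * y)))) μ :=
    fun i j => ((hint i).const_mul _).const_mul _
  simp_rw [← integral_finsetSum Finset.univ (fun j _ => h1 _ j)]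
  rw [← integral_finsetSum Finset.univ
    (fun i _ => integrable_finsetSum Finset.univ fun j _ => h1 i j)]
  congr 1
  ext k
  rw [hk, Finset.mul_sum]
  refine Finset.sum_congr rfl fun i _ => ?_
  rw [Finset.mul_sum]
  refine Finset.sum_congr rfl fun j _ => ?_
  ring

end DoubleCoset

/-- The compact open subgroups form a basis of neighbourhoods of the identity. -/
def HasCompactOpenBasis (G : Type) [Group G] [TopologicalSpace G] : Prop :=
  ∀ U ∈ 𝓝 (1 : G), ∃ V : Subgroup G, IsOpen (V : Set G) ∧ IsCompact (V : Set G) ∧ (V : Set G) ⊆ U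

section Representation

open scoped Pointwise

variable {G : Type} [Group G] [TopologicalSpace G] [IsTopologicalGroup G] [LocallyCompactSpace G]
  [T2Space G] [SecondCountableTopology G] [MeasurableSpace G] [BorelSpace G]
  {μ : Measure G} [μ.IsHaarMeasure]

lemma L1StarRep.norm_le_integral (ρ : L1StarRep μ) {f : G → ℂ} (hf : Integrable f μ) :
    ‖ρ.π f‖ ≤ ∫ x, ‖f x‖ ∂μ := by
  have h := ρ.norm_le f hf
  rwa [eLpNorm_one_eq_lintegral_enorm, ← integral_norm_eq_lintegral_enorm hf.1] at h

lemma L1StarRep.map_sub (ρ : L1StarRep μ) {f g : G → ℂ} (hf : Integrable f μ)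
    (hg : Integrable g μ) : ρ.π (f - g) = ρ.π f - ρ.π g := by
  have h := ρ.map_add (f - g) g (hf.sub hg) hg
  rw [sub_add_cancel] at h
  rw [h, add_sub_cancel_right]

lemma conv_subInd {V : Subgroup G} (hVo : IsOpen (V : Set G)) (g : G → ℂ) (x : G) :
    conv μ g (subInd V) x = ∫ v in V, g (x * v) ∂μ := by
  rw [← integral_subInd_mul hVo, conv, ← integral_mul_left_eq_self _ x]
  congr 1
  ext v
  rw [mul_inv_rev, inv_mul_cancel_right, subInd_inv, mul_comm]

/-- Continuous compactly supported functions are right uniformly continuous, with differences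
supported in a fixed compact set. -/
lemma exists_subgroup_norm_sub_le
    (hbasis : HasCompactOpenBasis G) {g : G → ℂ} (hg : Continuous g) (hgs : HasCompactSupport g) :
    ∃ K : Set G, IsCompact K ∧ ∀ ε > 0, ∃ V : Subgroup G, IsOpen (V : Set G) ∧
      IsCompact (V : Set G) ∧ ∀ x, ∀ v ∈ V, ‖g x - g (x * v)‖ ≤ K.indicator (fun _ => ε) x := by
  obtain ⟨V₁, hV₁open, hV₁c, -⟩ := hbasis Set.univ univ_mem
  have hK : IsCompact (tsupport g * (V₁ : Set G)) := hgs.isCompact.mul hV₁c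
  refine ⟨tsupport g * (V₁ : Set G), hK, fun ε hε => ?_⟩
  let S : Set (G × G) := {p | ‖g p.1 - g (p.1 * p.2)‖ < ε}
  have hS : IsOpen S := isOpen_lt (by fun_prop) continuous_const
  obtain ⟨A, B, hA, hB, hKA, h1B, hAB⟩ := generalized_tube_lemma hK
    (isCompact_singleton (x := (1 : G))) hS (by
      rintro ⟨x, v⟩ ⟨-, hv⟩
      obtain rfl : v = 1 := hv
      simpa [S] using hε)
  obtain ⟨V, hVo, hVc, hVB⟩ := hbasis (B ∩ V₁)
    ((hB.inter hV₁open).mem_nhds ⟨h1B rfl, V₁.one_mem⟩)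
  refine ⟨V, hVo, hVc, fun x v hv => ?_⟩
  by_cases hx : x ∈ tsupport g * (V₁ : Set G)
  · rw [Set.indicator_of_mem hx]
    exact (hAB (Set.mk_mem_prod (hKA hx) (hVB hv).1)).le
  · have h1 : g x = 0 := by
      by_contra h
      exact hx ⟨x, subset_tsupport g h, 1, V₁.one_mem, mul_one x⟩
    have h2 : g (x * v) = 0 := by
      by_contra h
      exact hx ⟨x * v, subset_tsupport g h, v⁻¹, V₁.inv_mem (hVB hv).2, by simp⟩
    rw [Set.indicator_of_notMem hx, h1, h2, sub_zero, norm_zero]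

lemma L1StarRep.eq_zero_of_subInd (ρ : L1StarRep μ)
    (hbasis : HasCompactOpenBasis G)
    (h0 : ∀ V : Subgroup G, IsOpen (V : Set G) → IsCompact (V : Set G) → ρ.π (subInd V) = 0)
    {f : G → ℂ} (hf : Integrable f μ) : ρ.π f = 0 := by
  have key : ∀ g : G → ℂ, Continuous g → HasCompactSupport g → Integrable g μ → ρ.π g = 0 := by
    intro g hg hgs hgi
    obtain ⟨K, hK, hKV⟩ := exists_subgroup_norm_sub_le hbasis hg hgs
    have hKm : MeasurableSet K := hK.measurableSet
    have hle : ∀ ε > 0, ‖ρ.π g‖ ≤ ε * μ.real K := by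
      intro ε hε
      obtain ⟨V, hVo, hVc, hV⟩ := hKV ε hε
      have hVpos : 0 < μ.real V :=
        ENNReal.toReal_pos (hVo.measure_pos μ ⟨1, V.one_mem⟩).ne' hVc.measure_lt_top.ne
      have hei : Integrable (subInd V) μ := integrable_subInd hVo hVc
      have hci := integrable_conv hgi hei
      have hzero : ρ.π (((μ.real V : ℂ)⁻¹) • conv μ g (subInd V)) = 0 := by
        rw [ρ.map_smul _ _ hci, ρ.map_conv _ _ hgi hei, h0 V hVo hVc]
        simp
      have h1 := ρ.map_sub hgi (hci.smul ((μ.real V : ℂ)⁻¹))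
      rw [hzero, sub_zero] at h1
      rw [← h1]
      refine (ρ.norm_le_integral (hgi.sub (hci.smul _))).trans ?_
      have hbound : ∀ x, ‖(g - ((μ.real V : ℂ)⁻¹) • conv μ g (subInd V)) x‖
          ≤ K.indicator (fun _ => ε) x := by
        intro x
        have hint : IntegrableOn (fun v => g (x * v)) V μ :=
          (hg.comp (continuous_const_mul x)).continuousOn.integrableOn_compact hVc
        have hx : (g - ((μ.real V : ℂ)⁻¹) • conv μ g (subInd V)) x
            = (μ.real V : ℂ)⁻¹ * ∫ v in V, (g x - g (x * v)) ∂μ := by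
          have hne : (μ.real V : ℂ) ≠ 0 := by exact_mod_cast hVpos.ne'
          have hconst : IntegrableOn (fun _ : G => g x) V μ :=
            integrableOn_const hVc.measure_lt_top.ne
          rw [integral_sub hconst hint, mul_sub,
            setIntegral_const, Pi.sub_apply, Pi.smul_apply, conv_subInd hVo, smul_eq_mul,
            Complex.real_smul, inv_mul_cancel_left₀ hne]
        rw [hx, norm_mul, norm_inv, Complex.norm_real, Real.norm_of_nonneg hVpos.le,
          inv_mul_le_iff₀ hVpos, mul_comm]
        exact norm_setIntegral_le_of_norm_le_const hVc.measure_lt_top (fun v hv => hV x v hv)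
      calc _ ≤ ∫ x, K.indicator (fun _ => ε) x ∂μ :=
            integral_mono (hgi.sub (hci.smul _)).norm
              ((integrable_indicator_iff hKm).2 (integrableOn_const hK.measure_lt_top.ne)) hbound
        _ = ε * μ.real K := by
            rw [integral_indicator hKm, setIntegral_const, smul_eq_mul, mul_comm]
    have h2 : ‖ρ.π g‖ ≤ 0 := by
      refine le_of_forall_pos_le_add fun δ hδ => ?_
      have hK0 : 0 ≤ μ.real K := measureReal_nonneg
      have := hle (δ / (μ.real K + 1)) (by positivity)
      rw [zero_add]
      refine this.trans ?_
      rw [div_mul_eq_mul_div, div_le_iff₀ (by positivity)]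
      nlinarith
    exact norm_le_zero_iff.1 h2
  have h2 : ‖ρ.π f‖ ≤ 0 := by
    refine le_of_forall_pos_le_add fun δ hδ => ?_
    obtain ⟨g, hgs, hfg, hg, hgi⟩ := hf.exists_hasCompactSupport_integral_sub_le hδ
    have h1 := ρ.map_sub hf hgi
    rw [key g hg hgs hgi, sub_zero] at h1
    rw [zero_add, ← h1]
    exact (ρ.norm_le_integral (hf.sub hgi)).trans hfg
  exact norm_le_zero_iff.1 h2

lemma L1StarRep.Nondegenerate.exists_ne_zero {ρ : L1StarRep μ} (hρ : ρ.Nondegenerate) :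
    ∃ f : G → ℂ, Integrable f μ ∧ ρ.π f ≠ 0 := by
  by_contra! h
  obtain ⟨v, hv⟩ := exists_ne (0 : ρ.H)
  have hspan : Submodule.span ℂ {x : ρ.H | ∃ (f : G → ℂ) (v : ρ.H),
      Integrable f μ ∧ x = ρ.π f v} = ⊥ := by
    rw [Submodule.span_eq_bot]
    rintro x ⟨f, w, hf, rfl⟩
    rw [h f hf]; rfl
  have hd := hρ
  rw [L1StarRep.Nondegenerate, hspan] at hd
  have : v ∈ closure ((⊥ : Submodule ℂ ρ.H) : Set ρ.H) := hd v
  simp at this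
  exact hv this

end Representation

section NotWiener

variable {G : Type} [Group G] [TopologicalSpace G] [IsTopologicalGroup G] [LocallyCompactSpace G]
  [T2Space G] [SecondCountableTopology G] [MeasurableSpace G] [BorelSpace G]
  {μ : Measure G} [μ.IsHaarMeasure]

/-- The integrable functions whose kernel is reproduced on both sides by the kernel `k`. -/
def reproducing {φ : G → ℂ} {C : ℝ} (hφ : Continuous φ) (hC : ∀ x, ‖φ x‖ ≤ C)
    {s t : Finset G} (c : s → t → ℂ) (k : G → G → ℂ) : Submodule ℂ (G → ℂ) where
  carrier := {b | Integrable b μ ∧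
    (∀ x y, kerInt μ φ b x y = ∑ i, ∑ j, c i j * (kerInt μ φ b x j * k i y)) ∧
    ∀ x y, kerInt μ φ b x y = ∑ i, ∑ j, c i j * (k x j * kerInt μ φ b i y)}
  zero_mem' := ⟨integrable_zero _ _ _, by simp [kerInt], by simp [kerInt]⟩
  add_mem' := by
    rintro a b ⟨ha, ha1, ha2⟩ ⟨hb, hb1, hb2⟩
    refine ⟨ha.add hb, fun x y => ?_, fun x y => ?_⟩
    · simp_rw [kerInt_add hφ hC ha hb]
      rw [ha1 x y, hb1 x y]
      simp_rw [← Finset.sum_add_distrib]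
      exact Finset.sum_congr rfl fun i _ => Finset.sum_congr rfl fun j _ => by ring
    · simp_rw [kerInt_add hφ hC ha hb]
      rw [ha2 x y, hb2 x y]
      simp_rw [← Finset.sum_add_distrib]
      exact Finset.sum_congr rfl fun i _ => Finset.sum_congr rfl fun j _ => by ring
  smul_mem' := by
    rintro z a ⟨ha, ha1, ha2⟩
    refine ⟨ha.smul z, fun x y => ?_, fun x y => ?_⟩
    · simp_rw [kerInt_smul]
      rw [ha1 x y]
      simp_rw [Finset.mul_sum]
      exact Finset.sum_congr rfl fun i _ => Finset.sum_congr rfl fun j _ => by ring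
    · simp_rw [kerInt_smul]
      rw [ha2 x y]
      simp_rw [Finset.mul_sum]
      exact Finset.sum_congr rfl fun i _ => Finset.sum_congr rfl fun j _ => by ring

lemma integrable_comp_mul_right {f : G → ℂ} (hf : Integrable f μ) (a : G) :
    Integrable (fun x => f (x * a)) μ := by
  have h := integrable_map_equiv (μ := μ) (MeasurableEquiv.mulRight a) f
  rw [MeasurableEquiv.coe_mulRight, Measure.map_right_mul_eq_modularCharacterFun_smul μ a] at h
  exact h.1 (hf.smul_measure_nnreal)

/-- If the kernels of `λⁿ b_n` converge pointwise to a kernel, and the `b_n` are reproducing,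
then the limit kernel is that of some integrable function and the operators converge. -/
lemma L1StarRep.exists_limit (ρ : L1StarRep μ) {φ : G → ℂ} {C : ℝ} (hφ : Continuous φ)
    (hC : ∀ x, ‖φ x‖ ≤ C) (hρ : ∀ f ∈ annihilator μ φ, ρ.π f = 0)
    {s t : Finset G} (c : s → t → ℂ) (k : G → G → ℂ) (b : ℕ → G → ℂ)
    (hb : ∀ n, b n ∈ reproducing (μ := μ) hφ hC c k) (ψ : G → G → ℂ)
    (hlim : ∀ x y, Tendsto (fun n => kerInt μ φ (b n) x y) atTop (𝓝 (ψ x y))) :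
    ∃ r, Integrable r μ ∧ (∀ x y, kerInt μ φ r x y = ψ x y) ∧
      Tendsto (fun n => ρ.π (b n)) atTop (𝓝 (ρ.π r)) := by
  let A := reproducing (μ := μ) hφ hC c k
  let T : A →ₗ[ℂ] (s × t → ℂ) :=
    { toFun := fun b p => kerInt μ φ b p.1 p.2
      map_add' := fun a b => by
        ext p; exact kerInt_add hφ hC a.2.1 b.2.1 _ _
      map_smul' := fun z a => by
        ext p; exact kerInt_smul _ _ _ _ }
  let R : A →ₗ[ℂ] (ρ.H →L[ℂ] ρ.H) :=
    { toFun := fun b => ρ.π b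
      map_add' := fun a b => ρ.map_add _ _ a.2.1 b.2.1
      map_smul' := fun z a => ρ.map_smul _ _ a.2.1 }
  have hdet : ∀ a : A, ∀ x y, kerInt μ φ a x y
      = ∑ i, ∑ j, c i j * ((∑ i', ∑ j', c i' j' * (k x j' * T a (i', j))) * k i y) := by
    intro a x y
    rw [a.2.2.1 x y]
    refine Finset.sum_congr rfl fun i _ => Finset.sum_congr rfl fun j _ => ?_
    rw [a.2.2.2 x j]
    rfl
  have hker : ∀ a, T a = 0 → R a = 0 := by
    intro a ha
    refine hρ _ ⟨a.2.1, fun x y => ?_⟩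
    rw [hdet, ha]
    simp
  obtain ⟨r, hr, hlr⟩ := tendsto_of_ker_le T R hker (fun n => ⟨b n, hb n⟩)
    (fun p => ψ p.1 p.2) (tendsto_pi_nhds.2 fun p => hlim _ _)
  refine ⟨r, r.2.1, fun x y => ?_, hlr⟩
  refine tendsto_nhds_unique ?_ (hlim x y)
  have h1 : ∀ n, kerInt μ φ (b n) x y = _ := fun n => hdet ⟨b n, hb n⟩ x y
  simp_rw [h1]
  rw [hdet]
  have hT : ∀ p, Tendsto (fun n => T ⟨b n, hb n⟩ p) atTop (𝓝 (T r p)) := fun p => by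
    rw [hr]; exact hlim _ _
  exact tendsto_finsetSum _ fun i _ => tendsto_finsetSum _ fun j _ =>
    ((tendsto_finsetSum _ fun i' _ => tendsto_finsetSum _ fun j' _ =>
      ((hT _).const_mul _).const_mul _).mul_const _).const_mul _

/-- If `φ(x)φ(y)` is the kernel of some `r ∈ L¹(G)` killed by `ρ`, then `ρ` kills the
indicator of every compact open subgroup. -/
lemma L1StarRep.subInd_eq_zero (ρ : L1StarRep μ) {φ : G → ℂ} {C : ℝ} (hφ : Continuous φ)
    (hC : ∀ x, ‖φ x‖ ≤ C) (hρ : ∀ f ∈ annihilator μ φ, ρ.π f = 0) {r : G → ℂ}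
    (hr : Integrable r μ) {d : ℂ} (hd : d ≠ 0)
    (hrφ : ∀ x y, kerInt μ φ r x y = d * (φ x * φ y)) (hr0 : ρ.π r = 0)
    {V : Subgroup G} (hVo : IsOpen (V : Set G)) (hVc : IsCompact (V : Set G))
    {s t : Finset G} {c : s → t → ℂ}
    (hk : ∀ x y, kerInt μ φ (subInd V) x y
      = ∑ i, ∑ j, c i j * (kerInt μ φ (subInd V) x j * kerInt μ φ (subInd V) i y)) :
    ρ.π (subInd V) = 0 := by
  have hei : Integrable (subInd V) μ := integrable_subInd hVo hVc
  let β : G → G → ℂ := fun y g => subInd V (g * y⁻¹)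
  let α : G → G → ℂ := fun x g => subInd V (x⁻¹ * g)
  have hβ : ∀ y, Integrable (β y) μ := fun y => integrable_comp_mul_right hei y⁻¹
  have hα : ∀ x, Integrable (α x) μ := fun x => hei.comp_mul_left x⁻¹
  have hβk : ∀ x y, kerInt μ φ (β y) x 1
      = (Measure.modularCharacterFun y⁻¹ : ℝ) * kerInt μ φ (subInd V) x y := fun x y => by
    rw [kerInt_comp_mul_right, mul_one, Complex.real_smul]
  have hαk : ∀ x y, kerInt μ φ (α x) 1 y = kerInt μ φ (subInd V) x y := fun x y => by
    rw [kerInt_comp_mul_left, one_mul]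
  let m : G → ℂ := fun y => ((Measure.modularCharacterFun y⁻¹ : ℝ) : ℂ)
  have hm : ∀ y, m y ≠ 0 := fun y => by
    simpa [m] using (Measure.modularCharacterFun_pos y⁻¹).ne'
  let F : G → G → G → ℂ := fun x y => conv μ (β y) (conv μ r (α x))
  have hF : ∀ x y, Integrable (F x y) μ := fun x y =>
    integrable_conv (hβ y) (integrable_conv hr (hα x))
  have hF0 : ∀ x y, ρ.π (F x y) = 0 := fun x y => by
    rw [ρ.map_conv _ _ (hβ y) (integrable_conv hr (hα x)), ρ.map_conv _ _ hr (hα x), hr0]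
    simp
  have hFk : ∀ x y u v, kerInt μ φ (F x y) u v
      = d * m y * (kerInt μ φ (subInd V) u y * kerInt μ φ (subInd V) x v) := by
    intro x y u v
    have h1 : ∀ w, kerInt μ φ (conv μ r (α x)) w v
        = d * φ w * kerInt μ φ (subInd V) x v := by
      intro w
      rw [kerInt_conv' hφ hC hr (hα x), ← hαk]
      simp_rw [hrφ]
      simp only [kerInt, one_mul]
      rw [← integral_const_mul]
      congr 1; ext l; ring
    rw [kerInt_conv hφ hC (hβ y) (integrable_conv hr (hα x))]
    simp_rw [h1]
    have h2 := hβk u y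
    simp only [kerInt, mul_one] at h2
    have h3 : ∀ z, β y z * (d * φ (u * z) * kerInt μ φ (subInd V) x v)
        = (d * kerInt μ φ (subInd V) x v) * (β y z * φ (u * z)) := fun z => by ring
    simp_rw [h3]
    rw [integral_const_mul, h2]
    simp only [kerInt, m]
    ring
  let S : G → ℂ := ∑ i : s, ∑ j : t, (c i j * (d * m j)⁻¹) • F i j
  have hadd : ∀ (ι : Type) (J : Finset ι) (f : ι → G → ℂ), (∀ i, Integrable (f i) μ) →
      (∀ i, ρ.π (f i) = 0) → Integrable (∑ i ∈ J, f i) μ ∧ ρ.π (∑ i ∈ J, f i) = 0 ∧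
      ∀ u v, kerInt μ φ (∑ i ∈ J, f i) u v = ∑ i ∈ J, kerInt μ φ (f i) u v := by
    intro ι J f hf hf0
    classical
    induction J using Finset.induction_on with
    | empty =>
      refine ⟨by simp, ?_, fun u v => by simp [kerInt]⟩
      exact hρ _ ⟨by simp, fun u v => by simp [kerInt]⟩
    | insert a J ha ih =>
      rw [Finset.sum_insert ha]
      refine ⟨(hf a).add ih.1, ?_, fun u v => ?_⟩
      · rw [ρ.map_add _ _ (hf a) ih.1, hf0, ih.2.1, add_zero]
      · rw [kerInt_add hφ hC (hf a) ih.1, ih.2.2, Finset.sum_insert ha]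
  have h1 := fun i : s => hadd t Finset.univ (fun j => (c i j * (d * m j)⁻¹) • F i j)
    (fun j => (hF _ _).smul _) (fun j => by rw [ρ.map_smul _ _ (hF _ _), hF0, smul_zero])
  have h2 := hadd s Finset.univ (fun i => ∑ j : t, (c i j * (d * m j)⁻¹) • F i j)
    (fun i => (h1 i).1) (fun i => (h1 i).2.1)
  have h3 : subInd V - S ∈ annihilator μ φ := by
    refine ⟨hei.sub h2.1, fun u v => ?_⟩
    have h4 := kerInt_add hφ hC (hei.sub h2.1) h2.1 u v
    rw [sub_add_cancel, h2.2.2, hk] at h4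
    simp_rw [(h1 _).2.2, kerInt_smul, hFk] at h4
    have h6 : ∀ (i : s) (j : t), c i j * (d * m j)⁻¹ *
        (d * m j * (kerInt μ φ (subInd V) u j * kerInt μ φ (subInd V) i v))
        = c i j * (kerInt μ φ (subInd V) u j * kerInt μ φ (subInd V) i v) := fun i j => by
      rw [mul_assoc, inv_mul_cancel_left₀ (mul_ne_zero hd (hm j))]
    simp_rw [h6] at h4
    exact right_eq_add.1 h4
  have h5 := ρ.map_add _ _ (hei.sub h2.1) h2.1
  rw [sub_add_cancel] at h5
  rw [h5, h2.2.1, add_zero]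
  exact hρ _ h3

/-- A criterion for a group to fail to be a Wiener group. -/
theorem not_isWienerGroup_of_kernel (hbasis : HasCompactOpenBasis G)
    {φ : G → ℂ} {C : ℝ} (hφ : Continuous φ) (hC : ∀ x, ‖φ x‖ ≤ C) (hφ1 : φ 1 ≠ 0)
    (hfin : ∀ V : Subgroup G, IsOpen (V : Set G) → IsCompact (V : Set G) →
      ∃ W : Submodule ℂ (G → ℂ), FiniteDimensional ℂ W ∧
        ∀ y, (fun x => ∫ v in V, φ (x * v * y) ∂μ) ∈ W)
    {V : Subgroup G} (hVo : IsOpen (V : Set G)) (hVc : IsCompact (V : Set G)) (h : G)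
    {z z' d : ℂ} (hd : d ≠ 0) (hz : ‖z‖ = 1) (hz' : ‖z'‖ = 1) (hzz : z * z' ≠ 1)
    (hD : Measure.modularCharacterFun h ≤ 1)
    (hlim : ∀ s t, Tendsto
      (fun n : ℕ => z ^ n * ∫ k in V, ∫ g in V, φ (s * k * h ^ n * g * t) ∂μ ∂μ)
      atTop (𝓝 (d * (φ s * φ t))))
    (hlim' : ∀ s t, ∃ l, Tendsto
      (fun n : ℕ => z' ^ n * ∫ k in V, ∫ g in V, φ (s * k * (h ^ n)⁻¹ * g * t) ∂μ ∂μ)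
      atTop (𝓝 l)) :
    ¬ IsWienerGroup μ := by
  intro hW
  have hskel : ∀ V : Subgroup G, IsOpen (V : Set G) → IsCompact (V : Set G) →
      ∃ (s t : Finset G) (c : s → t → ℂ), ∀ x y, kerInt μ φ (subInd V) x y
        = ∑ i, ∑ j, c i j * (kerInt μ φ (subInd V) x j * kerInt μ φ (subInd V) i y) := by
    intro V hVo hVc
    obtain ⟨W, hWf, hW⟩ := hfin V hVo hVc
    refine exists_skeleton _ W fun y => ?_
    simp_rw [kerInt_subInd hVo]
    exact hW y
  have hproper : ∃ f : G → ℂ, Integrable f μ ∧ f ∉ annihilator μ φ := by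
    by_contra! hall
    obtain ⟨U, hU1, hU⟩ : ∃ U ∈ 𝓝 (1 : G), ∀ g ∈ U, ‖φ g - φ 1‖ < ‖φ 1‖ / 2 := by
      have := Metric.continuousAt_iff'.1 (hφ.continuousAt (x := (1 : G))) (‖φ 1‖ / 2)
        (half_pos (norm_pos_iff.2 hφ1))
      exact ⟨_, this, fun g hg => by simpa [dist_eq_norm] using hg⟩
    obtain ⟨V, hVo, hVc, hVU⟩ := hbasis U hU1
    have h1 := (hall _ (integrable_subInd (μ := μ) hVo hVc)).2 1 1
    rw [kerInt_subInd hVo] at h1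
    simp only [one_mul, mul_one] at h1
    have hVpos : 0 < μ.real V :=
      ENNReal.toReal_pos (hVo.measure_pos μ ⟨1, V.one_mem⟩).ne' hVc.measure_lt_top.ne
    have hconst : IntegrableOn (fun _ : G => φ 1) V μ :=
      integrableOn_const hVc.measure_lt_top.ne
    have h2 := norm_setIntegral_le_of_norm_le_const (μ := μ) (f := fun g => φ g - φ 1)
      hVc.measure_lt_top (fun g hg => (hU g (hVU hg)).le)
    rw [integral_sub (hφ.continuousOn.integrableOn_compact hVc) hconst, h1, setIntegral_const,
      zero_sub, norm_neg, Complex.real_smul, norm_mul, Complex.norm_real,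
      Real.norm_of_nonneg hVpos.le] at h2
    have h3 : 0 < ‖φ 1‖ := norm_pos_iff.2 hφ1
    nlinarith
  obtain ⟨ρ, -, hnd, hρ⟩ := hW _ (isClosedIdealL1_annihilator hφ hC) hproper
  obtain ⟨s, t, c, hk⟩ := hskel V hVo hVc
  have hmem : ∀ a, cosetConv μ V a ∈ reproducing (μ := μ) hφ hC c (kerInt μ φ (subInd V)) :=
    fun a => ⟨integrable_cosetConv hVo hVc a, kerInt_cosetConv_right hVo hVc hφ hC hk a,
      kerInt_cosetConv_left hVo hVc hφ hC hk a⟩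
  have hint := fun a => integrable_cosetConv (μ := μ) hVo hVc a
  obtain ⟨r, hr, hrk, hrlim⟩ := ρ.exists_limit hφ hC hρ c _
    (fun n => z ^ n • cosetConv μ V (h ^ n)) (fun n => Submodule.smul_mem _ _ (hmem _))
    (fun x y => d * (φ x * φ y)) (fun x y => by
      simp_rw [kerInt_smul, kerInt_cosetConv_eq hVo hVc hφ hC]
      exact hlim x y)
  choose l hl using hlim'
  obtain ⟨r', hr', hrk', hrlim'⟩ := ρ.exists_limit hφ hC hρ c _
    (fun n => z' ^ n • cosetConv μ V (h ^ n)⁻¹) (fun n => Submodule.smul_mem _ _ (hmem _))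
    l (fun x y => by
      simp_rw [kerInt_smul, kerInt_cosetConv_eq hVo hVc hφ hC]
      exact hl x y)
  have hr0 : ρ.π r ≠ 0 := by
    intro hr0
    obtain ⟨f, hf, hf0⟩ := hnd.exists_ne_zero
    refine hf0 (ρ.eq_zero_of_subInd hbasis (fun V hVo hVc => ?_) hf)
    obtain ⟨s, t, c, hk⟩ := hskel V hVo hVc
    exact ρ.subInd_eq_zero hφ hC hρ hr hd hrk hr0 hVo hVc hk
  let D : ℝ := Measure.modularCharacterFun h
  have hDpos : 0 < D := Measure.modularCharacterFun_pos h
  have hDn : ∀ n : ℕ, (Measure.modularCharacterFun (h ^ n) : ℝ) = D ^ n := fun n => by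
    have := map_pow (Measure.modularCharacter (G := G)) h n
    simp only [Measure.modularCharacter, MonoidHom.coe_mk, OneHom.coe_mk] at this
    rw [this]
    simp [D]
  have hstar : ∀ n : ℕ, ρ.π (z' ^ n • cosetConv μ V (h ^ n)⁻¹)
      = (z * z' / (D : ℂ)) ^ n •
        ContinuousLinearMap.adjoint (ρ.π (z ^ n • cosetConv μ V (h ^ n))) := by
    intro n
    have h1 := ρ.map_star _ (hint (h ^ n))
    rw [starFun_cosetConv, ρ.map_smul _ _ (hint _), hDn] at h1
    rw [ρ.map_smul _ _ (hint _), ρ.map_smul _ _ (hint _), map_smulₛₗ, ← h1, smul_smul, smul_smul]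
    congr 1
    have hDc : (D : ℂ) ≠ 0 := by exact_mod_cast hDpos.ne'
    have hzc : z * (starRingEnd ℂ) z = 1 := by
      rw [Complex.mul_conj, Complex.normSq_eq_norm_sq, hz]; simp
    have hzn : z ^ n * (starRingEnd ℂ) (z ^ n) = 1 := by
      rw [map_pow, ← mul_pow, hzc, one_pow]
    rw [div_pow, mul_pow]
    push_cast
    field_simp
    linear_combination (-z' ^ n) * hzn
  have hadj : Tendsto (fun n : ℕ => ContinuousLinearMap.adjoint
      (ρ.π (z ^ n • cosetConv μ V (h ^ n)))) atTop (𝓝 (ContinuousLinearMap.adjoint (ρ.π r))) :=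
    (ContinuousLinearMap.adjoint.continuous.tendsto _).comp hrlim
  simp_rw [hstar] at hrlim'
  have hznorm : ‖z * z' / (D : ℂ)‖ = 1 / D := by
    rw [norm_div, norm_mul, hz, hz', Complex.norm_real, Real.norm_of_nonneg hDpos.le, one_mul]
  have hD1 : D ≤ 1 := by exact_mod_cast hD
  have hone := eq_one_of_tendsto_pow_smul
    (by rw [hznorm]; exact (one_le_div hDpos).2 hD1)
    (by simpa using hr0) hadj hrlim'
  rw [hone, norm_one] at hznorm
  have hD' : D = 1 := by field_simp at hznorm; exact hznorm
  rw [hD'] at hone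
  exact hzz (by simpa using hone)

end NotWiener

section Dynamics

variable {G Ω : Type} [Group G] [TopologicalSpace G] [TopologicalSpace Ω] [MulAction G Ω]

/-- Outside a compact set of group elements, `g` maps a given clopen set or its complement
to one side of another given clopen set. -/
def HasNorthSouth (G Ω : Type) [Group G] [TopologicalSpace G] [TopologicalSpace Ω]
    [MulAction G Ω] : Prop :=
  ∀ E F : Set Ω, IsClopen E → IsClopen F → ∃ K : Set G, IsCompact K ∧ ∀ g ∉ K,
    (∀ x ∈ E, g • x ∉ F) ∨ (∀ x ∈ E, g • x ∈ F) ∨ (∀ x ∉ E, g • x ∉ F) ∨ (∀ x ∉ E, g • x ∈ F)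

lemma exists_isClopen_pair [CompactSpace Ω] [T2Space Ω] [TotallyDisconnectedSpace Ω]
    {x₁ x₂ x₃ x₄ : Ω} (h12 : x₁ ≠ x₂) (h14 : x₁ ≠ x₄) (h32 : x₃ ≠ x₂) (h34 : x₃ ≠ x₄) :
    ∃ E : Set Ω, IsClopen E ∧ x₁ ∈ E ∧ x₃ ∈ E ∧ x₂ ∉ E ∧ x₄ ∉ E := by
  have hU : IsOpen ({x₂, x₄}ᶜ : Set Ω) := (Set.toFinite _).isClosed.isOpen_compl
  obtain ⟨A, hA, h1, hA'⟩ := compact_exists_isClopen_in_isOpen hU (x := x₁) (by simp [h12, h14])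
  obtain ⟨B, hB, h3, hB'⟩ := compact_exists_isClopen_in_isOpen hU (x := x₃) (by simp [h32, h34])
  refine ⟨A ∪ B, hA.union hB, Or.inl h1, Or.inr h3, ?_, ?_⟩ <;> rintro (h | h)
  · simpa using hA' h
  · simpa using hB' h
  · simpa using hA' h
  · simpa using hB' h

lemma HasNorthSouth.exists_isCompact [CompactSpace Ω] [T2Space Ω] [TotallyDisconnectedSpace Ω]
    (hN : HasNorthSouth G Ω) {F : Set Ω} (hF : IsClopen F)
    {x₁ x₂ x₃ x₄ : Ω} (h12 : x₁ ≠ x₂) (h14 : x₁ ≠ x₄) (h32 : x₃ ≠ x₂) (h34 : x₃ ≠ x₄) :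
    ∃ K : Set G, IsCompact K ∧
      ∀ g : G, g • x₁ ∈ F → g • x₂ ∈ F → g • x₃ ∉ F → g • x₄ ∉ F → g ∈ K := by
  obtain ⟨E, hE, e1, e3, e2, e4⟩ := exists_isClopen_pair h12 h14 h32 h34
  obtain ⟨K, hK, h⟩ := hN E F hE hF
  refine ⟨K, hK, fun g g1 g2 g3 g4 => ?_⟩
  by_contra hg
  rcases h g hg with h | h | h | h
  · exact h _ e1 g1
  · exact g3 (h _ e3)
  · exact h _ e2 g2
  · exact g4 (h _ e4)

/-- `h` fixes `a` and `b`, contracting the clopen set `E` to `a` and, inversely, `Eᶜ` to `b`. -/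
structure IsHyperbolic (h : G) (E : Set Ω) (a b : Ω) : Prop where
  clopen : IsClopen E
  mapsTo : ∀ x ∈ E, h • x ∈ E
  fix_a : h • a = a
  fix_b : h • b = b
  mem : a ∈ E
  not_mem : b ∉ E
  attr : ∀ N ∈ 𝓝 a, ∀ᶠ n : ℕ in atTop, ∀ x ∈ E, h ^ n • x ∈ N
  rep : ∀ N ∈ 𝓝 b, ∀ᶠ n : ℕ in atTop, ∀ x ∉ E, (h ^ n)⁻¹ • x ∈ N

lemma pow_smul_mem {h : G} {E : Set Ω} (hE : ∀ x ∈ E, h • x ∈ E) (n : ℕ) :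
    ∀ x ∈ E, h ^ n • x ∈ E := by
  induction n with
  | zero => simp
  | succ n ih =>
    intro x hx
    rw [pow_succ', mul_smul]
    exact hE _ (ih x hx)

lemma pow_inv_smul_not_mem {h : G} {E : Set Ω} (hE : ∀ x ∈ E, h • x ∈ E) (n : ℕ) :
    ∀ x ∉ E, (h ^ n)⁻¹ • x ∉ E := by
  intro x hx hx'
  exact hx (by simpa using pow_smul_mem hE n _ hx')

lemma pow_smul_fix {h : G} {a : Ω} (ha : h • a = a) (n : ℕ) : h ^ n • a = a := by
  induction n with
  | zero => simp
  | succ n ih => rw [pow_succ', mul_smul, ih, ha]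

lemma inv_smul_fix {h : G} {a : Ω} (ha : h • a = a) : h⁻¹ • a = a := by
  rw [inv_smul_eq_iff, ha]

variable [IsTopologicalGroup G] [ContinuousSMul G Ω]

lemma eventually_smul_mem [CompactSpace Ω] {E : Set Ω} (hE : IsClopen E) (g : G) :
    ∀ᶠ g' in 𝓝 g, ∀ x, (g⁻¹ * g') • x ∈ E ↔ x ∈ E := by
  have key : ∀ {E : Set Ω}, IsClopen E → ∀ᶠ g' in 𝓝 g, ∀ x ∈ E, (g⁻¹ * g') • x ∈ E := by
    intro E hE
    refine hE.1.isCompact.eventually_forall_of_forall_eventually fun y hy => ?_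
    have hc : Continuous fun z : G × Ω => (g⁻¹ * z.1) • z.2 := by fun_prop
    exact hc.continuousAt.eventually_mem (hE.2.mem_nhds (by simpa using hy))
  filter_upwards [key hE, key hE.compl] with g' h1 h2 x
  exact ⟨fun h => by_contra fun h' => h2 x h' h, h1 x⟩

lemma exists_attracting [CompactSpace Ω] [T2Space Ω] [TotallyDisconnectedSpace Ω]
    (hN : HasNorthSouth G Ω) {h : G} {E : Set Ω} (hE : IsClopen E)
    (hEE : ∀ x ∈ E, h • x ∈ E) {e : Ω} (he : e ∈ E) (he' : h⁻¹ • e ∉ E) :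
    ∃ a ∈ E, h • a = a ∧ ∀ N ∈ 𝓝 a, ∀ᶠ n : ℕ in atTop, ∀ x ∈ E, h ^ n • x ∈ N := by
  let A : ℕ → Set Ω := fun n => {x | (h ^ n)⁻¹ • x ∈ E}
  have hAcl : ∀ n, IsClosed (A n) := fun n => hE.1.preimage (continuous_const_smul _)
  have hAs : ∀ n, A (n + 1) ⊆ A n := by
    intro n x hx
    have := hEE _ hx
    rwa [pow_succ, mul_inv_rev, mul_smul, smul_inv_smul] at this
  have hanti : Antitone A := antitone_nat_of_succ_le hAs
  have hne : (⋂ n, A n).Nonempty := by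
    refine IsCompact.nonempty_iInter_of_sequence_nonempty_isCompact_isClosed A hAs
      (fun n => ⟨h ^ n • e, by simpa [A] using he⟩) (hAcl 0).isCompact hAcl
  have hsub : ∀ a ∈ ⋂ n, A n, ∀ a' ∈ ⋂ n, A n, a = a' := by
    intro a ha a' ha'
    by_contra hne
    rw [Set.mem_iInter] at ha ha'
    have haE : a ∈ E := by simpa [A] using ha 0
    have haE' : a' ∈ E := by simpa [A] using ha' 0
    have he2 : h⁻¹ • h⁻¹ • e ∉ E := fun hx => he' (by simpa using hEE _ hx)
    have he12 : h⁻¹ • e ≠ h⁻¹ • h⁻¹ • e := by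
      intro h0
      have := smul_left_cancel _ h0
      exact he' (this ▸ he)
    obtain ⟨K, hK, hmem⟩ := hN.exists_isCompact hE hne (x₃ := h⁻¹ • e) (x₄ := h⁻¹ • h⁻¹ • e)
      (fun h0 => he2 (h0 ▸ haE)) (fun h0 => he' (h0 ▸ haE')) he12
    have hall : ∀ n : ℕ, (h ^ n)⁻¹ ∈ K := fun n =>
      hmem _ (ha n) (ha' n) (pow_inv_smul_not_mem hEE n _ he') (pow_inv_smul_not_mem hEE n _ he2)
    obtain ⟨g, -, hg⟩ := hK.exists_mapClusterPt (f := atTop) (u := fun n : ℕ => (h ^ n)⁻¹)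
      (by simpa using ⟨0, fun b _ => hall b⟩)
    have hfr := hg.frequently (eventually_smul_mem hE g)
    obtain ⟨n, -, hn⟩ := (frequently_atTop.1 hfr) 0
    obtain ⟨m, hm, hm'⟩ := (frequently_atTop.1 hfr) (n + 1)
    obtain ⟨k, rfl⟩ := Nat.exists_eq_add_of_le hm
    have e1 := (hn (h⁻¹ • e)).not.2 he'
    have e2 := (hm' (h ^ k • e)).2 (pow_smul_mem hEE k e he)
    apply e1
    convert e2 using 1
    rw [← mul_smul, ← mul_smul]
    congr 1
    rw [pow_add, pow_succ]
    group
  obtain ⟨a, ha⟩ := hne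
  have haE : a ∈ E := by simpa [A] using Set.mem_iInter.1 ha 0
  refine ⟨a, haE, ?_, ?_⟩
  · refine hsub _ ?_ _ ha
    rw [Set.mem_iInter] at ha ⊢
    rintro (_ | n)
    · simpa [A] using hEE _ haE
    · have := ha n
      simp only [A, Set.mem_ofPred_eq] at this ⊢
      rwa [pow_succ', mul_inv_rev, mul_smul, inv_smul_smul]
  · intro N hNa
    obtain ⟨n, hn⟩ := exists_subset_nhds_of_isCompact (V := A)
      (hanti.directed_ge) (fun n => (hAcl n).isCompact) (U := N)
      (fun x hx => by rwa [hsub x hx a ha])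
    filter_upwards [eventually_ge_atTop n] with m hm x hx
    refine hn (hanti hm ?_)
    simpa [A] using hx

lemma exists_isHyperbolic [CompactSpace Ω] [T2Space Ω] [TotallyDisconnectedSpace Ω]
    (hN : HasNorthSouth G Ω) {h : G} {E : Set Ω} (hE : IsClopen E)
    (hEE : ∀ x ∈ E, h • x ∈ E) {e : Ω} (he : e ∈ E) (he' : h⁻¹ • e ∉ E) :
    ∃ a b, IsHyperbolic h E a b := by
  obtain ⟨a, ha, hfa, hatt⟩ := exists_attracting hN hE hEE he he'
  obtain ⟨b, hb, hfb, hrep⟩ := exists_attracting hN (h := h⁻¹) hE.compl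
    (fun x hx hx' => hx (by simpa using hEE _ hx')) (e := h⁻¹ • e) he' (by simpa using he)
  exact ⟨a, b, hE, hEE, hfa, by rw [← inv_smul_eq_iff.1 hfb], ha, hb, hatt, fun N hN => by
    simpa using hrep N hN⟩

namespace IsHyperbolic

variable {h : G} {E : Set Ω} {a b : Ω}

lemma ne (H : IsHyperbolic h E a b) : a ≠ b := fun h => H.not_mem (h ▸ H.mem)

lemma inv (H : IsHyperbolic h E a b) : IsHyperbolic h⁻¹ Eᶜ b a where
  clopen := H.clopen.compl
  mapsTo x hx hx' := hx (by simpa using H.mapsTo _ hx')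
  fix_a := inv_smul_fix H.fix_b
  fix_b := inv_smul_fix H.fix_a
  mem := H.not_mem
  not_mem := fun h => h H.mem
  attr N hN := by simpa using H.rep N hN
  rep N hN := by simpa using H.attr N hN

lemma conj (H : IsHyperbolic h E a b) (k : G) :
    IsHyperbolic (k * h * k⁻¹) {x | k⁻¹ • x ∈ E} (k • a) (k • b) where
  clopen := H.clopen.preimage (continuous_const_smul _)
  mapsTo x hx := by
    have := H.mapsTo _ hx
    simpa [mul_smul] using this
  fix_a := by simp [mul_smul, H.fix_a]
  fix_b := by simp [mul_smul, H.fix_b]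
  mem := by simpa using H.mem
  not_mem := by simpa using H.not_mem
  attr N hN := by
    filter_upwards [H.attr ((fun x => k • x) ⁻¹' N)
      ((continuous_const_smul k).continuousAt.preimage_mem_nhds hN)] with n hn x hx
    simpa [conj_pow, mul_smul] using hn _ hx
  rep N hN := by
    filter_upwards [H.rep ((fun x => k • x) ⁻¹' N)
      ((continuous_const_smul k).continuousAt.preimage_mem_nhds hN)] with n hn x hx
    simpa [conj_pow, mul_smul] using hn _ hx

lemma eventually_mem [T1Space Ω] (H : IsHyperbolic h E a b) {x : Ω} (hx : x ≠ b) :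
    ∀ᶠ n : ℕ in atTop, h ^ n • x ∈ E := by
  filter_upwards [H.rep {x}ᶜ (isOpen_compl_singleton.mem_nhds (by simpa using hx.symm))] with n hn
  by_contra hc
  simpa using hn _ hc

lemma tendsto [T1Space Ω] (H : IsHyperbolic h E a b) {x : Ω} (hx : x ≠ b) :
    Tendsto (fun n : ℕ => h ^ n • x) atTop (𝓝 a) := by
  obtain ⟨m, hm⟩ := (H.eventually_mem hx).exists
  intro N hN
  obtain ⟨n₀, hn₀⟩ := eventually_atTop.1 (H.attr N hN)
  refine mem_map.2 (mem_atTop_sets.2 ⟨n₀ + m, fun n hn => ?_⟩)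
  obtain ⟨k, rfl⟩ := Nat.exists_eq_add_of_le hn
  have := hn₀ (n₀ + k) (by omega) _ hm
  rwa [← mul_smul, ← pow_add, show n₀ + k + m = n₀ + m + k by ring] at this

end IsHyperbolic

end Dynamics

section Null

variable {G Ω : Type} [Group G] [TopologicalSpace G] [IsTopologicalGroup G] [LocallyCompactSpace G]
  [T2Space G] [SecondCountableTopology G]

lemma measure_preimage_mul_right [MeasurableSpace G] [BorelSpace G] {μ : Measure G}
    [μ.IsHaarMeasure] (A : Set G) (hA : MeasurableSet A) (g : G) :
    μ ((· * g) ⁻¹' A) = Measure.modularCharacterFun g * μ A := by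
  rw [← Measure.map_apply (measurable_mul_const g) hA,
    Measure.map_right_mul_eq_modularCharacterFun_smul μ g]
  rfl

variable [TopologicalSpace Ω] [MulAction G Ω] [ContinuousSMul G Ω] [CompactSpace Ω] [T2Space Ω]

lemma smul_mem_nhds [MulAction.IsPretransitive G Ω] {U : Set G} (hU : U ∈ 𝓝 1) (x : Ω) :
    {y | ∃ g ∈ U, g • x = y} ∈ 𝓝 x := by
  have := smul_singleton_mem_nhds_of_sigmaCompact hU x
  rw [Set.smul_singleton] at this
  exact this

variable [Infinite Ω]

variable (G) in
lemma singleton_not_mem_nhds [MulAction.IsPretransitive G Ω] (x : Ω) : ({x} : Set Ω) ∉ 𝓝 x := by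
  intro hx
  obtain ⟨U, hU, hUx⟩ : ∃ U ∈ 𝓝 (1 : G), ∀ g ∈ U, g • x = x := by
    have : Continuous fun g : G => g • x := by fun_prop
    refine ⟨_, this.continuousAt.preimage_mem_nhds (x := 1) (t := {x}) (by simpa using hx), ?_⟩
    intro g hg
    simpa using hg
  have hd : DiscreteTopology Ω := by
    refine discreteTopology_iff_singleton_mem_nhds.2 fun y => ?_
    obtain ⟨g, rfl⟩ := MulAction.exists_smul_eq G x y
    have hc : Continuous fun z : Ω => g⁻¹ • z := continuous_const_smul _
    have := hc.continuousAt.preimage_mem_nhds (x := g • x) (t := {x}) (by simpa using hx)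
    convert this using 1
    ext z
    simp [inv_smul_eq_iff]
  have := finite_of_compact_of_discrete (X := Ω)
  exact not_finite Ω

lemma measure_smul_eq_eq_zero [MulAction.IsPretransitive G Ω] [MeasurableSpace G] [BorelSpace G]
    {μ : Measure G} [μ.IsHaarMeasure] (a b : Ω) : μ {g | g • a = b} = 0 := by
  by_contra hpos
  have hc : Continuous fun g : G => g • a := by fun_prop
  have hmeas : MeasurableSet {g : G | g • a = b} :=
    (isClosed_singleton.preimage hc).measurableSet
  have hst := Measure.div_mem_nhds_one_of_haar_pos μ _ hmeas (pos_iff_ne_zero.2 hpos)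
  have h1 := smul_mem_nhds hst b
  refine singleton_not_mem_nhds G b (mem_of_superset h1 ?_)
  rintro y ⟨g, ⟨g₁, hg₁, g₂, hg₂, rfl⟩, rfl⟩
  simp only [Set.mem_ofPred_eq] at hg₁ hg₂
  simp [div_eq_mul_inv, mul_smul, ← hg₁, inv_smul_eq_iff]
  rw [hg₁, hg₂]

end Null

section Modular

variable {P Ω : Type} [Group P] [TopologicalSpace P] [IsTopologicalGroup P] [LocallyCompactSpace P]
  [T2Space P] [SecondCountableTopology P]
  [TopologicalSpace Ω] [MulAction P Ω] [ContinuousSMul P Ω] [CompactSpace Ω] [T2Space Ω]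
  [TotallyDisconnectedSpace Ω] [Infinite Ω]

lemma exists_last_int {S : ℤ → Prop} (h1 : ∀ᶠ n : ℕ in atTop, S n) (h2 : ∃ n : ℤ, ¬ S n) :
    ∃ i : ℤ, ¬ S i ∧ ∀ j > i, S j := by
  obtain ⟨N, hN⟩ := eventually_atTop.1 h1
  obtain ⟨i, hi, hi'⟩ := Int.exists_greatest_of_bdd (P := fun n => ¬ S n) ⟨N, fun z hz => by
    by_contra hc
    refine hz ?_
    obtain ⟨k, rfl⟩ := Int.eq_ofNat_of_zero_le (show 0 ≤ z by omega)
    exact hN k (by omega)⟩ h2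
  exact ⟨i, hi, fun j hj => by_contra fun hc => absurd (hi' j hc) (by omega)⟩

/-- The elements `p` sending `a` into `E` and for which `0` is the last index at which the orbit
`p hⁱ x` is outside `E`. -/
def lastExit (h : P) (a x : Ω) (E : Set Ω) : Set P :=
  {p | p • a ∈ E ∧ p • x ∉ E ∧ ∀ i : ℤ, 0 < i → p • h ^ i • x ∈ E}

lemma lastExit_unique {h : P} {a x : Ω} {E : Set Ω} {p : P} {i j : ℤ}
    (hi : p * h ^ i ∈ lastExit h a x E) (hj : p * h ^ j ∈ lastExit h a x E) : i = j := by
  have key : ∀ {i j : ℤ}, p * h ^ i ∈ lastExit h a x E → p * h ^ j ∈ lastExit h a x E →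
      ¬ i < j := by
    intro i j hi hj hij
    refine hj.2.1 ?_
    have := hi.2.2 (j - i) (by omega)
    rwa [← mul_smul, mul_assoc, ← zpow_add, add_sub_cancel] at this
  exact le_antisymm (not_lt.1 (key hj hi)) (not_lt.1 (key hi hj))

lemma measurableSet_lastExit [MeasurableSpace P] [BorelSpace P] (h : P) (a x : Ω) {E : Set Ω}
    (hE : IsClopen E) : MeasurableSet (lastExit h a x E) := by
  have hc : ∀ y : Ω, Continuous fun g : P => g • y := fun y => by fun_prop
  have : lastExit h a x E = (fun g : P => g • a) ⁻¹' E ∩ ((fun g : P => g • x) ⁻¹' Eᶜ ∩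
      ⋂ i : ℤ, ⋂ _ : 0 < i, (fun g : P => g • h ^ i • x) ⁻¹' E) := by
    ext p
    simp [lastExit]
  rw [this]
  refine ((hE.1.preimage (hc _)).inter ((hE.2.isClosed_compl.preimage (hc _)).inter ?_)).measurableSet
  exact isClosed_iInter fun i => isClosed_iInter fun _ => hE.1.preimage (hc _)

lemma IsHyperbolic.exists_lastExit {h : P} {E : Set Ω} {a b : Ω} (H : IsHyperbolic h E a b)
    {x : Ω} (hxa : x ≠ a) (hxb : x ≠ b) {p : P} (hp : p • b = b) (hpa : p • a ∈ E) :
    ∃ i : ℤ, p * h ^ i ∈ lastExit h a x E := by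
  have hfix : ∀ i : ℤ, h ^ i • a = a := fun i => by
    have : h ∈ MulAction.stabilizer P a := H.fix_a
    exact (MulAction.stabilizer P a).zpow_mem this i
  have hc : Continuous fun y : Ω => p • y := continuous_const_smul p
  obtain ⟨i, hi, hi'⟩ := exists_last_int (S := fun i : ℤ => p • h ^ i • x ∈ E) (by
      have := (hc.tendsto a).comp (H.tendsto hxb)
      filter_upwards [this (H.clopen.2.mem_nhds hpa)] with n hn
      simpa using hn) (by
      have := (hc.tendsto b).comp (H.inv.tendsto hxa)
      obtain ⟨n, hn⟩ := (this.eventually (H.clopen.1.isOpen_compl.mem_nhds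
        (by simpa [hp] using H.not_mem))).exists
      exact ⟨-n, by simpa using hn⟩)
  refine ⟨i, by rwa [mul_smul, hfix], by rwa [mul_smul], fun j hj => ?_⟩
  rw [mul_smul, ← mul_smul (h ^ i), ← zpow_add]
  exact hi' _ (by omega)

theorem IsHyperbolic.modularCharacterFun_lt_one {h : P} {E : Set Ω} {a b : Ω}
    (hN : HasNorthSouth P Ω) (H : IsHyperbolic h E a b) (hb : ∀ p : P, p • b = b) {p₀ : P}
    (hp₀ : p₀ • a ≠ a) : Measure.modularCharacterFun h < 1 := by
  by_contra! hge
  borelize P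
  let m : Measure P := Measure.haar
  obtain ⟨x, hx⟩ := Set.Infinite.nonempty (s := ({a, b} : Set Ω)ᶜ)
    (Set.Finite.infinite_compl (Set.toFinite _))
  simp only [Set.mem_compl_iff, Set.mem_insert_iff, Set.mem_singleton_iff, not_or] at hx
  obtain ⟨hxa, hxb⟩ := hx
  let E' : Set Ω := {y | h⁻¹ • y ∈ E}
  have hE' : IsClopen E' := H.clopen.preimage (continuous_const_smul _)
  have hsub : E' ⊆ E := fun y hy => by simpa using H.mapsTo _ hy
  let Y : Set P := {p | p • a ∈ E'}
  have hcont : ∀ y : Ω, Continuous fun g : P => g • y := fun y => by fun_prop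
  have hY : IsClopen Y := hE'.preimage (hcont a)
  let D := lastExit h a x E
  let D' := lastExit h a x E'
  have hD : MeasurableSet D := measurableSet_lastExit h a x H.clopen
  have hD' : MeasurableSet D' := measurableSet_lastExit h a x hE'
  have hDD' : m D = m D' := by
    have : D = (h * ·) ⁻¹' D' := by
      ext p
      simp [D, D', lastExit, E', mul_smul]
    rw [this, measure_preimage_mul]
  have hfin : m D < ⊤ := by
    have hxx : x ≠ h • x := by
      intro h0
      have h1 := H.tendsto hxb
      have h2 : (fun n : ℕ => h ^ n • x) = fun _ => x := funext fun n => pow_smul_fix h0.symm n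
      rw [h2] at h1
      exact hxa (tendsto_nhds_unique tendsto_const_nhds h1)
    have hax : a ≠ h • x := by
      intro h0
      exact hxa (smul_left_cancel h (h0.symm.trans H.fix_a.symm))
    obtain ⟨K, hK, hmem⟩ := hN.exists_isCompact H.clopen hax H.ne hxx hxb
    refine (measure_mono ?_).trans_lt hK.measure_lt_top
    rintro p ⟨h1, h2, h3⟩
    refine hmem p h1 ?_ h2 ?_
    · simpa using h3 1 one_pos
    · rw [hb]; exact H.not_mem
  let T : ℕ → Set P := fun j => D ∩ (· * h ^ j) ⁻¹' D'
  have hT : ∀ j, MeasurableSet (T j) := fun j => hD.inter (measurable_mul_const _ hD')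
  have hcover : D' ⊆ ⋃ j, (· * (h ^ j)⁻¹) ⁻¹' T j := by
    intro p hp
    obtain ⟨i, hi⟩ := H.exists_lastExit hxa hxb (hb p) (hsub hp.1)
    have hi0 : i ≤ 0 := by
      by_contra! hlt
      refine hi.2.1 ?_
      rw [mul_smul]
      exact hsub (hp.2.2 i hlt)
    obtain ⟨j, hj⟩ := Int.eq_ofNat_of_zero_le (show 0 ≤ -i by omega)
    obtain rfl : i = -j := by omega
    refine Set.mem_iUnion.2 ⟨j, ?_, ?_⟩
    · simpa using hi
    · simpa using hp
  have hmod : ∀ j : ℕ, Measure.modularCharacterFun (h ^ j)⁻¹ ≤ 1 := by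
    intro j
    change Measure.modularCharacter (h ^ j)⁻¹ ≤ 1
    rw [map_inv, map_pow]
    exact inv_le_one_of_one_le₀ (one_le_pow₀ hge)
  have hTm : ∀ j, m ((· * (h ^ j)⁻¹) ⁻¹' T j) ≤ m (T j) := by
    intro j
    rw [measure_preimage_mul_right _ (hT j)]
    exact mul_le_of_le_one_left' (by exact_mod_cast hmod j)
  have hTdisj : Pairwise (Function.onFun Disjoint T) := by
    intro i j hij
    rw [Function.onFun, Set.disjoint_left]
    rintro p ⟨-, h1⟩ ⟨-, h2⟩
    refine hij ?_
    have := lastExit_unique (p := p) (i := i) (j := j) (h := h) (a := a) (x := x) (E := E')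
      (by simpa using h1) (by simpa using h2)
    exact_mod_cast this
  have hTsub : (⋃ j, T j) ⊆ D ∩ Y := by
    refine Set.iUnion_subset fun j p hp => ⟨hp.1, ?_⟩
    have := hp.2.1
    rwa [mul_smul, pow_smul_fix H.fix_a] at this
  have hle : m D ≤ m (D ∩ Y) := calc
    m D = m D' := hDD'
    _ ≤ ∑' j, m ((· * (h ^ j)⁻¹) ⁻¹' T j) := (measure_mono hcover).trans (measure_iUnion_le _)
    _ ≤ ∑' j, m (T j) := ENNReal.tsum_le_tsum hTm
    _ = m (⋃ j, T j) := (measure_iUnion hTdisj hT).symm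
    _ ≤ m (D ∩ Y) := measure_mono hTsub
  have hnull : m (D \ Y) = 0 := by
    have h1 := measure_inter_add_sdiff (μ := m) D hY.1.measurableSet
    have h2 : m (D ∩ Y) + m (D \ Y) ≤ m (D ∩ Y) + 0 := by rw [h1, add_zero]; exact hle
    have h3 : m (D ∩ Y) ≠ ⊤ := ((measure_mono Set.inter_subset_left).trans_lt hfin).ne
    exact nonpos_iff_eq_zero.1 ((ENNReal.add_le_add_iff_left h3).1 h2)
  have hempty : {p : P | p • a ∈ E} \ Y = ∅ := by
    have hopen : IsOpen ({p : P | p • a ∈ E} \ Y) :=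
      (H.clopen.2.preimage (hcont a)).sdiff hY.1
    refine (hopen.measure_eq_zero_iff m).1 (measure_mono_null (t := ⋃ i : ℤ,
      (· * h ^ i) ⁻¹' (D \ Y)) ?_ ?_)
    · rintro p ⟨hp, hpY⟩
      obtain ⟨i, hi⟩ := H.exists_lastExit hxa hxb (hb p) hp
      refine Set.mem_iUnion.2 ⟨i, hi, fun hc => hpY ?_⟩
      have hfix : h ^ i • a = a := by
        have : h ∈ MulAction.stabilizer P a := H.fix_a
        exact (MulAction.stabilizer P a).zpow_mem this i
      simp only [Y, Set.mem_ofPred_eq] at hc ⊢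
      rwa [mul_smul, hfix] at hc
    · refine measure_iUnion_null fun i => ?_
      rw [measure_mul_right_null, hnull]
  have hstep : ∀ p : P, p • a ∈ E → h⁻¹ • p • a ∈ E := by
    intro p hp
    by_contra hc
    have : p ∈ {p : P | p • a ∈ E} \ Y := ⟨hp, hc⟩
    rw [hempty] at this
    exact this
  have hall : ∀ (n : ℕ) (p : P), p • a ∈ E → (h⁻¹ ^ n) • p • a ∈ E := by
    intro n
    induction n with
    | zero => simp
    | succ n ih =>
      intro p hp
      have := ih (h⁻¹ * p) (by simpa [mul_smul] using hstep p hp)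
      rwa [mul_smul, ← mul_smul, ← pow_succ] at this
  have hfixa : ∀ p : P, p • a ∈ E → p • a = a := by
    intro p hp
    by_contra hne
    obtain ⟨n, hn⟩ := (H.inv.eventually_mem hne).exists
    exact hn (hall n p hp)
  have hpb : p₀ • a ≠ b := fun h0 => H.ne (smul_left_cancel p₀ (h0.trans (hb p₀).symm))
  obtain ⟨n, hn⟩ := (H.eventually_mem hpb).exists
  have := hfixa (h ^ n * p₀) (by rwa [mul_smul])
  rw [mul_smul, ← pow_smul_fix H.fix_a n, smul_left_cancel_iff, pow_smul_fix H.fix_a] at this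
  exact hp₀ this

end Modular

section Character

variable {G Ω : Type} [Group G] [TopologicalSpace G] [IsTopologicalGroup G] [LocallyCompactSpace G]
  [T2Space G] [SecondCountableTopology G]
  [TopologicalSpace Ω] [MulAction G Ω] [ContinuousSMul G Ω] [CompactSpace Ω] [T2Space Ω]

lemma modularCharacterFun_eq_one_of_mem {Q : Subgroup G} (hQo : IsOpen (Q : Set G))
    (hQc : IsCompact (Q : Set G)) {p : G} (hp : p ∈ Q) : Measure.modularCharacterFun p = 1 := by
  borelize G
  let m : Measure G := Measure.haar
  have h1 := measure_preimage_mul_right (μ := m) (Q : Set G) hQo.measurableSet p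
  have h2 : (· * p) ⁻¹' (Q : Set G) = Q := by
    ext x
    simp [Q.mul_mem_cancel_right hp]
  have h3 : m Q ≠ 0 := (hQo.measure_pos m ⟨1, Q.one_mem⟩).ne'
  have h4 : m Q ≠ ⊤ := hQc.measure_lt_top.ne
  rw [h2] at h1
  have h5 : (Measure.modularCharacterFun p : ENNReal) = 1 := by
    rw [← ENNReal.mul_left_inj h3 h4, ← h1, one_mul]
  exact_mod_cast h5

variable [Infinite Ω] [MulAction.IsPretransitive G Ω]

lemma IsHyperbolic.smul_eq_of_stabilizer_fix {h : G} {E : Set Ω} {a b : Ω}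
    (H : IsHyperbolic h E a b) (hfix : ∀ p : G, p • b = b → p • a = a) {k : G} (hk : k • b = a) :
    k • a = b := by
  by_contra hne
  have h1 : (k⁻¹ * h * k) • a = a := hfix _ (by
    rw [mul_smul, mul_smul, hk, H.fix_a, ← hk, inv_smul_smul])
  have h2 : h • k • a = k • a := by
    rw [mul_smul, mul_smul, inv_smul_eq_iff] at h1
    exact h1
  have h3 := H.tendsto hne
  rw [show (fun n : ℕ => h ^ n • k • a) = fun _ => k • a from
    funext fun n => pow_smul_fix h2 n] at h3
  have h4 : k • a = a := tendsto_nhds_unique tendsto_const_nhds h3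
  exact H.ne (smul_left_cancel k (h4.trans hk.symm))

lemma IsHyperbolic.exists_stabilizer_ne {h : G} {E : Set Ω} {a b : Ω}
    (H : IsHyperbolic h E a b) : ∃ p : G, p • b = b ∧ p • a ≠ a := by
  by_contra! hfix
  obtain ⟨k, hk⟩ := MulAction.exists_smul_eq G b a
  have hka := H.smul_eq_of_stabilizer_fix hfix hk
  have key : ∀ g : G, g • b ≠ b → g • a = b := by
    intro g hg
    by_contra hne
    have hU : {u : G | u • b ∈ Eᶜ} ∈ 𝓝 (1 : G) := by
      have : Continuous fun u : G => u • b := by fun_prop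
      exact (H.clopen.compl.2.preimage this).mem_nhds (by simpa using H.not_mem)
    have h1 := (H.tendsto hg).eventually (smul_mem_nhds hU a)
    obtain ⟨n, ⟨u, hu, hun⟩, hn⟩ := (h1.and
      (H.eventually_mem hne)).exists
    refine hu ?_
    have h2 : ((u * k)⁻¹ * (h ^ n * g)) • b = b := by
      rw [mul_smul, inv_smul_eq_iff, mul_smul, mul_smul, hk, hun]
    have h3 := hfix _ h2
    rw [mul_smul, inv_smul_eq_iff, mul_smul, mul_smul, hka] at h3
    rwa [← h3]
  obtain ⟨x, hx⟩ := Set.Infinite.nonempty (s := ({a, b} : Set Ω)ᶜ)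
    (Set.Finite.infinite_compl (Set.toFinite _))
  simp only [Set.mem_compl_iff, Set.mem_insert_iff, Set.mem_singleton_iff, not_or] at hx
  obtain ⟨g, rfl⟩ := MulAction.exists_smul_eq G a x
  exact hx.1 (hfix g (by_contra fun hc => hx.2 (key g hc)))

lemma isClosed_stabilizer (b : Ω) : IsClosed (MulAction.stabilizer G b : Set G) := by
  have : Continuous fun u : G => u • b := by fun_prop
  exact isClosed_singleton.preimage this

instance (b : Ω) : LocallyCompactSpace (MulAction.stabilizer G b) :=
  (isClosed_stabilizer b).isClosedEmbedding_subtypeVal.locallyCompactSpace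

instance (b : Ω) : SecondCountableTopology (MulAction.stabilizer G b) :=
  Topology.IsEmbedding.subtypeVal.secondCountableTopology

lemma HasNorthSouth.stabilizer (hN : HasNorthSouth G Ω) (b : Ω) :
    HasNorthSouth (MulAction.stabilizer G b) Ω := by
  intro E F hE hF
  obtain ⟨K, hK, h⟩ := hN E F hE hF
  exact ⟨_, (isClosed_stabilizer b).isClosedEmbedding_subtypeVal.isCompact_preimage hK,
    fun g hg => h g hg⟩

lemma IsHyperbolic.stabilizer {h : G} {E : Set Ω} {a b : Ω} (H : IsHyperbolic h E a b) :
    IsHyperbolic (⟨h, H.fix_b⟩ : MulAction.stabilizer G b) E a b :=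
  ⟨H.clopen, H.mapsTo, H.fix_a, H.fix_b, H.mem, H.not_mem, H.attr, H.rep⟩

lemma IsHyperbolic.modularCharacterFun_stabilizer_lt_one [TotallyDisconnectedSpace Ω]
    (hN : HasNorthSouth G Ω) {h : G} {E : Set Ω} {a b : Ω} (H : IsHyperbolic h E a b) :
    Measure.modularCharacterFun (⟨h, H.fix_b⟩ : MulAction.stabilizer G b) < 1 := by
  obtain ⟨p, hp, hpa⟩ := H.exists_stabilizer_ne
  exact H.stabilizer.modularCharacterFun_lt_one (hN.stabilizer b) (fun q => q.2)
    (p₀ := ⟨p, hp⟩) hpa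

/-- The unitary character `p ↦ Δ(p)^{iτ}` of a locally compact group. -/
def modularPhase (P : Type) [Group P] [TopologicalSpace P] [IsTopologicalGroup P]
    [LocallyCompactSpace P] (τ : ℝ) : P →* ℂ where
  toFun p := Complex.exp ((τ * Real.log (Measure.modularCharacterFun p) : ℝ) * Complex.I)
  map_one' := by simp [Measure.modularCharacterFun_map_one]
  map_mul' p q := by
    rw [Measure.modularCharacterFun_map_mul, NNReal.coe_mul, Real.log_mul, mul_add,
      Complex.ofReal_add, add_mul, Complex.exp_add]
    · exact_mod_cast (Measure.modularCharacterFun_pos p).ne'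
    · exact_mod_cast (Measure.modularCharacterFun_pos q).ne'

lemma IsHyperbolic.exists_character [TotallyDisconnectedSpace Ω]
    (hN : HasNorthSouth G Ω) {h h' : G} {E E' : Set Ω} {a a' b : Ω} (H : IsHyperbolic h E a b)
    (H' : IsHyperbolic h' E' a' b) :
    ∃ χ : MulAction.stabilizer G b →* ℂ, (∀ p, ‖χ p‖ = 1) ∧
      (∀ U : Subgroup G, IsOpen (U : Set G) → IsCompact (U : Set G) →
        ∀ p : MulAction.stabilizer G b, (p : G) ∈ U → χ p = 1) ∧
      χ ⟨h, H.fix_b⟩ * χ ⟨h', H'.fix_b⟩ = -1 := by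
  set x := Real.log (Measure.modularCharacterFun (⟨h, H.fix_b⟩ : MulAction.stabilizer G b)) with hx
  set y := Real.log (Measure.modularCharacterFun (⟨h', H'.fix_b⟩ : MulAction.stabilizer G b)) with hy
  have hx0 : x < 0 := Real.log_neg (by exact_mod_cast Measure.modularCharacterFun_pos _)
    (by exact_mod_cast H.modularCharacterFun_stabilizer_lt_one hN)
  have hy0 : y < 0 := Real.log_neg (by exact_mod_cast Measure.modularCharacterFun_pos _)
    (by exact_mod_cast H'.modularCharacterFun_stabilizer_lt_one hN)
  refine ⟨modularPhase _ (Real.pi / (x + y)), fun p => Complex.norm_exp_ofReal_mul_I _, ?_, ?_⟩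
  · intro U hUo hUc p hp
    have hemb := (isClosed_stabilizer (G := G) b).isClosedEmbedding_subtypeVal
    have := modularCharacterFun_eq_one_of_mem (G := MulAction.stabilizer G b)
      (Q := U.comap (MulAction.stabilizer G b).subtype) (hUo.preimage hemb.continuous)
      (hemb.isCompact_preimage hUc) (p := p) hp
    simp [modularPhase, this]
  · change Complex.exp (((Real.pi / (x + y)) * x : ℝ) * Complex.I) *
      Complex.exp (((Real.pi / (x + y)) * y : ℝ) * Complex.I) = -1
    rw [← Complex.exp_add, ← add_mul, ← Complex.ofReal_add, ← mul_add,
      div_mul_cancel₀ _ (by linarith : x + y ≠ 0), Complex.exp_pi_mul_I]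

end Character

section Integrals

variable {G : Type} [Group G] [TopologicalSpace G] [IsTopologicalGroup G] [LocallyCompactSpace G]
  [T2Space G] [SecondCountableTopology G] [MeasurableSpace G] [BorelSpace G]
  {μ : Measure G} [μ.IsHaarMeasure]

lemma setIntegral_subgroup_mul_left {V : Subgroup G} (hVo : IsOpen (V : Set G)) {w : G}
    (hw : w ∈ V) (f : G → ℂ) : ∫ v in V, f (w * v) ∂μ = ∫ v in V, f v ∂μ := by
  rw [← integral_indicator hVo.measurableSet, ← integral_indicator hVo.measurableSet,
    ← integral_mul_left_eq_self ((V : Set G).indicator f) w]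
  congr 1 with v
  have : w * v ∈ (V : Set G) ↔ v ∈ (V : Set G) := V.mul_mem_cancel_left hw
  by_cases hv : v ∈ (V : Set G)
  · rw [Set.indicator_of_mem hv, Set.indicator_of_mem (this.2 hv)]
  · rw [Set.indicator_of_notMem hv, Set.indicator_of_notMem (mt this.1 hv)]

lemma continuous_of_right_invariant {V : Subgroup G} (hVo : IsOpen (V : Set G)) {f : G → ℂ}
    (hf : ∀ x, ∀ v ∈ V, f (x * v) = f x) : Continuous f := by
  refine continuous_iff_continuousAt.2 fun x => ?_
  refine (continuousAt_const (y := f x)).congr ?_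
  have hc : Continuous fun y : G => x⁻¹ * y := by fun_prop
  filter_upwards [(hVo.preimage hc).mem_nhds (show x ∈ _ by simp [V.one_mem])] with y hy
  have := hf x _ hy
  rw [mul_inv_cancel_left] at this
  exact this.symm

lemma integral_swap_of_continuous {V W : Set G} (hV : IsCompact V) (hW : IsCompact W)
    {f : G → G → ℂ} {C : ℝ} (hf : Continuous fun p : G × G => f p.1 p.2)
    (hC : ∀ x y, ‖f x y‖ ≤ C) :
    ∫ x in V, ∫ y in W, f x y ∂μ ∂μ = ∫ y in W, ∫ x in V, f x y ∂μ ∂μ := by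
  have : IsFiniteMeasure (μ.restrict V) := ⟨by simpa using hV.measure_lt_top⟩
  have : IsFiniteMeasure (μ.restrict W) := ⟨by simpa using hW.measure_lt_top⟩
  refine integral_integral_swap ?_
  exact Integrable.of_bound (by exact hf.aestronglyMeasurable) C (.of_forall fun p => hC p.1 p.2)

lemma norm_setIntegral_le {V : Set G} (hV : IsCompact V) {f : G → ℂ} {C : ℝ}
    (hC : ∀ x, ‖f x‖ ≤ C) : ‖∫ x in V, f x ∂μ‖ ≤ C * μ.real V :=
  norm_setIntegral_le_of_norm_le_const hV.measure_lt_top fun x _ => hC x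

lemma tendsto_double_integral {V W : Set G} (hV : IsCompact V) (hW : IsCompact W)
    {F : ℕ → G → G → ℂ} {L : G → G → ℂ} {C : ℝ}
    (hF : ∀ n, Continuous fun p : G × G => F n p.1 p.2) (hC : ∀ n x y, ‖F n x y‖ ≤ C)
    (hL : ∀ x, ∀ᵐ y ∂μ, Tendsto (fun n => F n x y) atTop (𝓝 (L x y))) :
    Tendsto (fun n => ∫ x in V, ∫ y in W, F n x y ∂μ ∂μ) atTop
      (𝓝 (∫ x in V, ∫ y in W, L x y ∂μ ∂μ)) := by
  have : IsFiniteMeasure (μ.restrict V) := ⟨by simpa using hV.measure_lt_top⟩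
  have : IsFiniteMeasure (μ.restrict W) := ⟨by simpa using hW.measure_lt_top⟩
  refine tendsto_integral_of_dominated_convergence (fun _ => C * μ.real W) (fun n => ?_)
    (integrable_const _) (fun n => .of_forall fun x => norm_setIntegral_le hW (hC n x))
    (.of_forall fun x => ?_)
  · exact ((hF n).stronglyMeasurable.integral_prod_right' (f := fun p : G × G => F n p.1 p.2)
      (ν := μ.restrict W)).aestronglyMeasurable
  · refine tendsto_integral_of_dominated_convergence (fun _ => C) (fun n => ?_)
      (integrable_const _) (fun n => .of_forall fun y => hC n x y)
      (ae_restrict_of_ae (hL x))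
    exact ((hF n).comp (by fun_prop : Continuous fun y : G => (x, y))).aestronglyMeasurable

end Integrals

section Equivariant

variable {G Ω : Type} [Group G] [MulAction G Ω] {b : Ω}

/-- Functions transforming on the left under the stabilizer of `b` by the character `χ`. -/
def IsEquivariant (χ : MulAction.stabilizer G b →* ℂ) (f : G → ℂ) : Prop :=
  ∀ (p : MulAction.stabilizer G b) (x : G), f (p * x) = χ p * f x

lemma IsEquivariant.integral [TopologicalSpace G] [MeasurableSpace G] {μ : Measure G}
    {χ : MulAction.stabilizer G b →* ℂ} {f : G → ℂ} (hf : IsEquivariant χ f) (V : Set G) (t : G) :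
    IsEquivariant χ fun x => ∫ v in V, f (x * v * t) ∂μ := by
  intro p x
  simp_rw [mul_assoc, hf p]
  exact integral_const_mul _ _

lemma IsEquivariant.apply_eq {χ : MulAction.stabilizer G b →* ℂ} {f : G → ℂ}
    (hf : IsEquivariant χ f) {N : Subgroup G} (hN : ∀ x, ∀ v ∈ N, f (x * v) = f x) {x k w : G}
    (hx : x⁻¹ • b = w • k • b) (hw : w ∈ N) :
    ∃ hp : (x * w * k) • b = b, f x = χ ⟨x * w * k, hp⟩ * f k⁻¹ := by
  have hp : (x * w * k) • b = b := by rw [mul_smul, mul_smul, ← hx, smul_inv_smul]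
  refine ⟨hp, ?_⟩
  rw [← hf, ← hN x w hw]
  simp

lemma IsEquivariant.apply_mul {χ : MulAction.stabilizer G b →* ℂ} {f : G → ℂ}
    (hf : IsEquivariant χ f) {N : Subgroup G} (hN : ∀ x, ∀ v ∈ N, f (x * v) = f x) {x k w g : G}
    (hg : g • k • b = k • b) (hg' : (k⁻¹ * g * k) • b = b)
    (hx : x⁻¹ • b = w • k • b) (hw : w ∈ N) (hw' : g⁻¹ * w * g ∈ N) :
    f (x * g) = χ ⟨k⁻¹ * g * k, hg'⟩ * f x := by
  obtain ⟨hp, h1⟩ := hf.apply_eq hN hx hw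
  obtain ⟨hq, h2⟩ := hf.apply_eq hN (x := x * g) (k := k) (w := g⁻¹ * w * g)
    (by simp only [mul_inv_rev, mul_smul, hx, hg]) hw'
  have hpq : (⟨x * g * (g⁻¹ * w * g) * k, hq⟩ : MulAction.stabilizer G b) =
      ⟨x * w * k, hp⟩ * ⟨k⁻¹ * g * k, hg'⟩ := Subtype.ext (by simp [mul_assoc])
  rw [h1, h2, hpq, map_mul]
  ring

end Equivariant

section Asymptotics

variable {G Ω : Type} [Group G] [TopologicalSpace G] [IsTopologicalGroup G] [LocallyCompactSpace G]
  [T2Space G] [SecondCountableTopology G]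
  [TopologicalSpace Ω] [MulAction G Ω] [ContinuousSMul G Ω] [CompactSpace Ω] [T2Space Ω]
  [MulAction.IsPretransitive G Ω] {b : Ω}

lemma mem_nhds_of_isOpen {N : Subgroup G} (hN : IsOpen (N : Set G)) (g : G) :
    {w : G | w ∈ N ∧ g⁻¹ * w * g ∈ N} ∈ 𝓝 (1 : G) := by
  have hc : Continuous fun w : G => g⁻¹ * w * g := by fun_prop
  exact inter_mem (hN.mem_nhds N.one_mem) ((hN.preimage hc).mem_nhds (by simp [N.one_mem]))

/-- If `g` is hyperbolic with attracting point `α`, repelling point `k • b`, an equivariant function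
is eventually multiplied by a constant along `x gⁿ`. -/
lemma IsHyperbolic.eventually_apply_mul {g k : G} {E : Set Ω} {α : Ω}
    (H : IsHyperbolic g E α (k • b)) {χ : MulAction.stabilizer G b →* ℂ} {f : G → ℂ}
    (hf : IsEquivariant χ f) {N : Subgroup G} (hNo : IsOpen (N : Set G))
    (hN : ∀ x, ∀ v ∈ N, f (x * v) = f x) (hg' : (k⁻¹ * g * k) • b = b) {x : G}
    (hx : x⁻¹ • b ≠ α) :
    ∀ᶠ n : ℕ in atTop, f (x * g ^ (n + 1)) = χ ⟨k⁻¹ * g * k, hg'⟩ * f (x * g ^ n) := by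
  have h1 := (H.inv.tendsto hx).eventually (smul_mem_nhds (mem_nhds_of_isOpen hNo g) (k • b))
  filter_upwards [h1] with n hn
  obtain ⟨w, hw, hwn⟩ := hn
  rw [pow_succ, ← mul_assoc]
  exact hf.apply_mul hN H.fix_b hg' (w := w)
    (by rw [hwn, mul_inv_rev, mul_smul, inv_pow]) hw.1 hw.2

lemma exists_tendsto_of_eventually_mul {c : ℂ} (hc : c ≠ 0) {u : ℕ → ℂ}
    (h : ∀ᶠ n in atTop, u (n + 1) = c * u n) : ∃ l, Tendsto (fun n => c⁻¹ ^ n * u n) atTop (𝓝 l) := by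
  obtain ⟨N, hN⟩ := eventually_atTop.1 h
  refine ⟨c⁻¹ ^ N * u N, tendsto_const_nhds.congr' ?_⟩
  filter_upwards [eventually_ge_atTop N] with n hn
  induction n, hn using Nat.le_induction with
  | base => rfl
  | succ n hn ih =>
    rw [ih, hN n hn, pow_succ]
    field_simp

open Classical in
/-- The equivariant function supported on `stabilizer b * U`. -/
def cellFun (χ : MulAction.stabilizer G b →* ℂ) (U : Subgroup G) (x : G) : ℂ :=
  if h : ∃ p : MulAction.stabilizer G b, (p : G)⁻¹ * x ∈ U then χ h.choose else 0

section CellFun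

variable {χ : MulAction.stabilizer G b →* ℂ} {U : Subgroup G}

lemma cellFun_eq (hχ : ∀ p : MulAction.stabilizer G b, (p : G) ∈ U → χ p = 1)
    {x : G} {p : MulAction.stabilizer G b} (hp : (p : G)⁻¹ * x ∈ U) :
    cellFun χ U x = χ p := by
  have h : ∃ p : MulAction.stabilizer G b, (p : G)⁻¹ * x ∈ U := ⟨p, hp⟩
  rw [cellFun, dif_pos h]
  have h1 := hχ (p⁻¹ * h.choose) (by
    have := U.mul_mem hp (U.inv_mem h.choose_spec)
    simpa [mul_assoc] using this)
  rw [map_mul] at h1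
  calc χ h.choose = χ p * (χ p⁻¹ * χ h.choose) := by
        rw [← mul_assoc, ← map_mul, mul_inv_cancel, map_one, one_mul]
    _ = χ p := by rw [h1, mul_one]

lemma isEquivariant_cellFun (hχ : ∀ p : MulAction.stabilizer G b, (p : G) ∈ U → χ p = 1) :
    IsEquivariant χ (cellFun χ U) := by
  intro p x
  by_cases h : ∃ q : MulAction.stabilizer G b, (q : G)⁻¹ * x ∈ U
  · obtain ⟨q, hq⟩ := h
    rw [cellFun_eq hχ hq, cellFun_eq hχ (p := p * q) (by simpa [mul_assoc] using hq), map_mul]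
  · have h' : ¬ ∃ q : MulAction.stabilizer G b, (q : G)⁻¹ * (p * x) ∈ U := by
      rintro ⟨q, hq⟩
      exact h ⟨p⁻¹ * q, by simpa [mul_assoc] using hq⟩
    rw [cellFun, cellFun, dif_neg h, dif_neg h', mul_zero]

lemma cellFun_mul (hχ : ∀ p : MulAction.stabilizer G b, (p : G) ∈ U → χ p = 1)
    (x : G) {v : G} (hv : v ∈ U) : cellFun χ U (x * v) = cellFun χ U x := by
  by_cases h : ∃ q : MulAction.stabilizer G b, (q : G)⁻¹ * x ∈ U
  · obtain ⟨q, hq⟩ := h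
    rw [cellFun_eq hχ hq, cellFun_eq hχ (p := q) (by
      rw [← mul_assoc]; exact U.mul_mem hq hv)]
  · have h' : ¬ ∃ q : MulAction.stabilizer G b, (q : G)⁻¹ * (x * v) ∈ U := by
      rintro ⟨q, hq⟩
      refine h ⟨q, ?_⟩
      rwa [← mul_assoc, U.mul_mem_cancel_right hv] at hq
    rw [cellFun, cellFun, dif_neg h, dif_neg h']

lemma norm_cellFun_le (hχ : ∀ p : MulAction.stabilizer G b, (p : G) ∈ U → χ p = 1)
    (hχ1 : ∀ p, ‖χ p‖ = 1) (x : G) : ‖cellFun χ U x‖ ≤ 1 := by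
  by_cases h : ∃ q : MulAction.stabilizer G b, (q : G)⁻¹ * x ∈ U
  · obtain ⟨q, hq⟩ := h
    rw [cellFun_eq hχ hq, hχ1]
  · rw [cellFun, dif_neg h]
    simp

end CellFun

/-- The limit of the renormalized values of `cellFun` along `x hⁿ`. -/
structure IsCellLimit (χ : MulAction.stabilizer G b →* ℂ) (U : Subgroup G) (h : G) (a : Ω) (z : ℂ)
    (ψ : G → ℂ) : Prop where
  tendsto : ∀ x, x⁻¹ • b ≠ a → Tendsto (fun n : ℕ => z ^ n * cellFun χ U (x * h ^ n)) atTop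
    (𝓝 (ψ x))
  equivariant : IsEquivariant χ ψ
  norm_le : ∀ x, ‖ψ x‖ ≤ 1

lemma IsHyperbolic.exists_isCellLimit [MeasurableSpace G] [BorelSpace G] {h : G} {E : Set Ω} {a : Ω}
    (H : IsHyperbolic h E a b)
    {χ : MulAction.stabilizer G b →* ℂ} (hχ1 : ∀ p, ‖χ p‖ = 1) {U : Subgroup G}
    (hUo : IsOpen (U : Set G)) (hχ : ∀ p : MulAction.stabilizer G b, (p : G) ∈ U → χ p = 1) :
    ∃ ψ : G → ℂ, IsCellLimit χ U h a (χ ⟨h, H.fix_b⟩)⁻¹ ψ ∧ Measurable ψ ∧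
      ∃ N ∈ 𝓝 (1 : G), ∀ x ∈ N, ψ x = 1 := by
  classical
  set c := χ ⟨h, H.fix_b⟩ with hc
  have hc1 : ‖c‖ = 1 := hχ1 _
  have hc0 : c ≠ 0 := by
    intro h0
    rw [h0, norm_zero] at hc1
    exact zero_ne_one hc1
  have hlim : ∀ x : G, ∃ l, (x⁻¹ • b = a → l = 0) ∧ (x⁻¹ • b ≠ a →
      Tendsto (fun n : ℕ => c⁻¹ ^ n * cellFun χ U (x * h ^ n)) atTop (𝓝 l)) := by
    intro x
    by_cases hx : x⁻¹ • b = a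
    · exact ⟨0, fun _ => rfl, fun h => absurd hx h⟩
    · have hmul := (IsHyperbolic.eventually_apply_mul (k := 1) (by simpa using H) (isEquivariant_cellFun hχ) hUo
          (fun x v hv => cellFun_mul hχ x hv) (by simpa using H.fix_b) hx)
      simp only [inv_one, one_mul, mul_one] at hmul
      obtain ⟨l, hl⟩ := exists_tendsto_of_eventually_mul hc0
        (u := fun n : ℕ => cellFun χ U (x * h ^ n)) hmul
      exact ⟨l, fun h => absurd h hx, fun _ => hl⟩
  choose ψ hψ0 hψ using hlim
  refine ⟨ψ, ⟨hψ, ?_, ?_⟩, ?_, ?_⟩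
  · intro p x
    have hpx : ((p : G) * x)⁻¹ • b = x⁻¹ • b := by
      rw [mul_inv_rev, mul_smul, inv_smul_fix p.2]
    by_cases hx : x⁻¹ • b = a
    · rw [hψ0 x hx, hψ0 _ (hpx.trans hx), mul_zero]
    · refine tendsto_nhds_unique (hψ _ (by rwa [hpx])) (((hψ x hx).const_mul (χ p)).congr ?_)
      intro n
      rw [mul_assoc (p : G), isEquivariant_cellFun hχ p]
      ring
  · intro x
    by_cases hx : x⁻¹ • b = a
    · simp [hψ0 x hx]
    · refine le_of_tendsto (hψ x hx).norm (.of_forall fun n => ?_)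
      rw [norm_mul, norm_pow, norm_inv, hc1]
      simpa using norm_cellFun_le hχ hχ1 _
  · have hcont : Continuous fun x : G => x⁻¹ • b := by fun_prop
    refine measurable_of_tendsto_metrizable (f := fun (n : ℕ) (x : G) =>
      {x : G | x⁻¹ • b ≠ a}.indicator (fun x => c⁻¹ ^ n * cellFun χ U (x * h ^ n)) x) ?_ ?_
    · intro n
      refine Measurable.indicator ?_ (isOpen_compl_singleton.preimage hcont).measurableSet
      have := continuous_of_right_invariant hUo (fun x v hv => cellFun_mul hχ x hv)
      exact (continuous_const.mul (this.comp (continuous_mul_const _))).measurable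
    · refine tendsto_pi_nhds.2 fun x => ?_
      by_cases hx : x⁻¹ • b = a
      · simp [hx, hψ0 x hx]
      · simpa [hx] using hψ x hx
  · obtain ⟨n₀, hn₀⟩ := eventually_atTop.1
      (H.rep _ (smul_mem_nhds (mem_nhds_of_isOpen hUo h) b))
    have hcont : Continuous fun x : G => x⁻¹ • b := by fun_prop
    have hcont' : Continuous fun x : G => (h ^ n₀)⁻¹ * x * h ^ n₀ := by fun_prop
    refine ⟨_, inter_mem ((H.clopen.compl.2.preimage hcont).mem_nhds (by simpa using H.not_mem))
      ((hUo.preimage hcont').mem_nhds (by simp [U.one_mem] : (1 : G) ∈ _)), ?_⟩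
    rintro x ⟨hx1, hx2⟩
    have hstep : ∀ n ≥ n₀, cellFun χ U (x * h ^ n) = c ^ n := by
      intro n hn
      induction n, hn using Nat.le_induction with
      | base =>
        rw [cellFun_eq hχ (p := ⟨h, H.fix_b⟩ ^ n₀) (by simpa [mul_assoc] using hx2), map_pow]
      | succ n hn ih =>
        obtain ⟨w, hw, hwn⟩ := hn₀ n hn _ hx1
        have := (isEquivariant_cellFun hχ).apply_mul (fun x v hv => cellFun_mul hχ x hv) (k := 1)
          (g := h) (x := x * h ^ n) (w := w) (by simpa using H.fix_b) (by simpa using H.fix_b)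
          (by rw [one_smul, hwn, mul_inv_rev, mul_smul]) hw.1 hw.2
        rw [pow_succ, ← mul_assoc, this, ih, pow_succ, mul_comm]
        simp [hc]
    have hxa : x⁻¹ • b ≠ a := fun h0 => hx1 (by
      simpa only [h0] using H.mem)
    refine tendsto_nhds_unique (hψ x hxa) (tendsto_const_nhds.congr' ?_)
    filter_upwards [eventually_ge_atTop n₀] with n hn
    rw [hstep n hn, ← mul_pow, inv_mul_cancel₀ hc0, one_pow]

lemma IsHyperbolic.tendsto_mul {h : G} {E : Set Ω} {a : Ω} (H : IsHyperbolic h E a b)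
    {χ : MulAction.stabilizer G b →* ℂ} {U : Subgroup G}
    (hUo : IsOpen (U : Set G)) (hχ : ∀ p : MulAction.stabilizer G b, (p : G) ∈ U → χ p = 1)
    {z : ℂ} {ψ : G → ℂ} (hψ : IsCellLimit χ U h a z ψ) {θ : G → ℂ} (hθ : IsEquivariant χ θ)
    {N : Subgroup G} (hNo : IsOpen (N : Set G)) (hN : ∀ x, ∀ v ∈ N, θ (x * v) = θ x) {x : G}
    (hx : x⁻¹ • b ≠ a) :
    Tendsto (fun n : ℕ => z ^ n * θ (x * h ^ n)) atTop (𝓝 (θ 1 * ψ x)) := by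
  refine ((hψ.tendsto x hx).const_mul (θ 1)).congr' ?_
  filter_upwards [(H.inv.tendsto hx).eventually (smul_mem_nhds (inter_mem (hNo.mem_nhds N.one_mem)
    (hUo.mem_nhds U.one_mem)) b)] with n hn
  obtain ⟨w, hw, hwn⟩ := hn
  have hxn : (x * h ^ n)⁻¹ • b = w • (1 : G) • b := by
    rw [one_smul, hwn, mul_inv_rev, mul_smul, inv_pow]
  obtain ⟨hp, h1⟩ := hθ.apply_eq hN hxn hw.1
  obtain ⟨hq, h2⟩ := (isEquivariant_cellFun hχ).apply_eq (fun x v hv => cellFun_mul hχ x hv) hxn hw.2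
  have h3 : cellFun χ U (1 : G) = 1 := by
    rw [cellFun_eq hχ (p := 1) (by simp), map_one]
  rw [h1, h2, inv_one, h3]
  ring

end Asymptotics

section Spherical

variable {G Ω : Type} [Group G] [TopologicalSpace G] [IsTopologicalGroup G] [LocallyCompactSpace G]
  [T2Space G] [SecondCountableTopology G] [MeasurableSpace G] [BorelSpace G]
  {μ : Measure G} [μ.IsHaarMeasure]
  [TopologicalSpace Ω] [MulAction G Ω] [ContinuousSMul G Ω] [CompactSpace Ω] [T2Space Ω]
  [MulAction.IsPretransitive G Ω] {b : Ω}

lemma setIntegral_right_invariant {V : Subgroup G} (hVo : IsOpen (V : Set G)) (f : G → ℂ) (t : G) :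
    ∀ x, ∀ w ∈ V, ∫ v in V, f (x * w * v * t) ∂μ = ∫ v in V, f (x * v * t) ∂μ := by
  intro x w hw
  have := setIntegral_subgroup_mul_left (μ := μ) hVo hw fun v => f (x * v * t)
  simpa only [mul_assoc] using this

lemma integral_average_eq {V : Subgroup G} (hVo : IsOpen (V : Set G)) (hVc : IsCompact (V : Set G))
    {f : G → ℂ} {C : ℝ} (hf : Continuous f) (hC : ∀ x, ‖f x‖ ≤ C) (s y t : G) :
    ∫ k in V, ∫ g in V, ∫ u in V, f (u * (s * k * y * g * t)) ∂μ ∂μ ∂μ =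
      ∫ u in V, ∫ k in V, ∫ g in V, f (u * s * k * y * g * t) ∂μ ∂μ ∂μ := by
  have hθ : Continuous fun x => ∫ g in V, f (x * g * t) ∂μ :=
    continuous_of_right_invariant hVo (setIntegral_right_invariant hVo f t)
  rw [integral_swap_of_continuous (f := fun u k => ∫ g in V, f (u * s * k * y * g * t) ∂μ)
    (C := C * μ.real V) hVc hVc (hθ.comp (g := fun x => ∫ g in V, f (x * g * t) ∂μ)
      (f := fun p : G × G => p.1 * s * p.2 * y) (by fun_prop))
    (fun _ _ => norm_setIntegral_le hVc fun _ => hC _)]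
  refine integral_congr_ae (.of_forall fun k => ?_)
  simp only
  rw [integral_swap_of_continuous (C := C) hVc hVc (by fun_prop) fun _ _ => hC _]
  simp only [mul_assoc]

/-- The equivariant functions which are invariant on the right under `V`. -/
def equivariantSubmodule (χ : MulAction.stabilizer G b →* ℂ) (V : Subgroup G) :
    Submodule ℂ (G → ℂ) where
  carrier := {f | IsEquivariant χ f ∧ ∀ x, ∀ v ∈ V, f (x * v) = f x}
  add_mem' := by
    rintro f g ⟨h1, h2⟩ ⟨h3, h4⟩
    refine ⟨fun p x => ?_, fun x v hv => ?_⟩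
    · simp only [Pi.add_apply, h1 p, h3 p, mul_add]
    · simp only [Pi.add_apply, h2 x v hv, h4 x v hv]
  zero_mem' := ⟨fun p x => by simp, fun x v hv => rfl⟩
  smul_mem' := by
    rintro c f ⟨h1, h2⟩
    refine ⟨fun p x => ?_, fun x v hv => ?_⟩
    · simp only [Pi.smul_apply, h1 p, smul_eq_mul, mul_left_comm]
    · simp only [Pi.smul_apply, h2 x v hv]

lemma finiteDimensional_equivariantSubmodule (χ : MulAction.stabilizer G b →* ℂ) {V : Subgroup G}
    (hVo : IsOpen (V : Set G)) : FiniteDimensional ℂ (equivariantSubmodule χ V) := by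
  choose r hr using fun ω : Ω => MulAction.exists_smul_eq G b ω
  obtain ⟨t, -, ht⟩ := isCompact_univ.elim_nhds_subcover
    (fun ω : Ω => {y | ∃ g ∈ (V : Set G), g • ω = y})
    fun ω _ => smul_mem_nhds (hVo.mem_nhds V.one_mem) ω
  let ev : equivariantSubmodule χ V →ₗ[ℂ] (t → ℂ) :=
    { toFun := fun f ω => f.1 (r ω)⁻¹
      map_add' := fun _ _ => rfl
      map_smul' := fun _ _ => rfl }
  refine FiniteDimensional.of_injective ev ?_
  rw [← LinearMap.ker_eq_bot, LinearMap.ker_eq_bot']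
  rintro ⟨f, hf, hfV⟩ h0
  ext x
  obtain ⟨ω, hω, v, hv, hx⟩ : ∃ ω ∈ t, ∃ v ∈ V, v • ω = x⁻¹ • b := by
    have := ht (Set.mem_univ (x⁻¹ • b))
    simpa using this
  obtain ⟨hp, h1⟩ := hf.apply_eq hfV (x := x) (k := r ω) (w := v) (by rw [hr, hx]) hv
  have h2 : f (r ω)⁻¹ = 0 := congrFun h0 ⟨ω, hω⟩
  change f x = 0
  rw [h1, h2, mul_zero]

lemma exists_finiteDimensional_average {χ : MulAction.stabilizer G b →* ℂ} {V₀ V : Subgroup G}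
    (hV₀o : IsOpen (V₀ : Set G)) (hV₀c : IsCompact (V₀ : Set G)) {f : G → ℂ} {C : ℝ}
    (hf : IsEquivariant χ f) (hfV : ∀ x, ∀ v ∈ V₀, f (x * v) = f x) (hC : ∀ x, ‖f x‖ ≤ C)
    (hVo : IsOpen (V : Set G)) (hVc : IsCompact (V : Set G)) :
    ∃ W : Submodule ℂ (G → ℂ), FiniteDimensional ℂ W ∧
      ∀ y, (fun x => ∫ v in V, ∫ u in V₀, f (u * (x * v * y)) ∂μ ∂μ) ∈ W := by
  have := finiteDimensional_equivariantSubmodule χ hVo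
  have hint : ∀ g ∈ equivariantSubmodule χ V, ∀ x : G,
      Integrable (fun u => g (u * x)) (μ.restrict V₀) := by
    intro g hg x
    exact ((continuous_of_right_invariant hVo hg.2).comp
      (continuous_mul_const x)).continuousOn.integrableOn_compact hV₀c
  let T : equivariantSubmodule χ V →ₗ[ℂ] (G → ℂ) :=
    { toFun := fun g x => ∫ u in V₀, g.1 (u * x) ∂μ
      map_add' := fun g h => by
        ext x
        exact integral_add (hint g.1 g.2 x) (hint h.1 h.2 x)
      map_smul' := fun c g => by
        ext x
        exact integral_const_mul c _ }
  refine ⟨LinearMap.range T, inferInstance, fun y => ?_⟩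
  refine ⟨⟨fun s => ∫ v in V, f (s * v * y) ∂μ, hf.integral V y,
    setIntegral_right_invariant hVo f y⟩, ?_⟩
  ext x
  have hcont := continuous_of_right_invariant hV₀o hfV
  rw [integral_swap_of_continuous (C := C) hVc hV₀c (by fun_prop) fun _ _ => hC _]
  simp only [T, LinearMap.coe_mk, AddHom.coe_mk, mul_assoc]

variable [TotallyDisconnectedSpace Ω] [Infinite Ω]

lemma ae_smul_ne (s : G) (a : Ω) : ∀ᵐ k ∂μ, (s * k)⁻¹ • b ≠ a := by
  rw [ae_iff]
  convert measure_smul_eq_eq_zero (μ := μ) a (s⁻¹ • b) using 2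
  ext k
  simp only [ne_eq, not_not, mul_inv_rev, mul_smul, inv_smul_eq_iff, Set.mem_ofPred_eq,
    eq_inv_smul_iff]
  exact eq_comm

theorem IsHyperbolic.not_isWienerGroup_of_le_one (hbasis : HasCompactOpenBasis G)
    (hN : HasNorthSouth G Ω) {h : G} {E : Set Ω} {a : Ω} (H : IsHyperbolic h E a b)
    (hD : Measure.modularCharacterFun h ≤ 1) : ¬ IsWienerGroup μ := by
  obtain ⟨k₀, hk₀⟩ := MulAction.exists_smul_eq G b a
  have H' := H.inv.conj k₀⁻¹
  rw [show k₀⁻¹ • a = b by rw [← hk₀, inv_smul_smul], inv_inv] at H'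
  obtain ⟨χ, hχ1, hχU, hχ⟩ := H.exists_character hN H'
  have hχ0 : ∀ p, χ p ≠ 0 := fun p h0 => by simpa [h0] using hχ1 p
  obtain ⟨U, hUo, hUc, -⟩ := hbasis Set.univ univ_mem
  obtain ⟨ψ, hψ, hψm, N, hN1, hψN⟩ := H.exists_isCellLimit hχ1 hUo (hχU U hUo hUc)
  obtain ⟨V, hVo, hVc, hVN⟩ := hbasis N hN1
  set Φ : G → ℂ := fun x => ∫ v in V, ψ (x * v * 1) ∂μ with hΦ
  have hΦe : IsEquivariant χ Φ := hψ.equivariant.integral V 1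
  have hΦV : ∀ x, ∀ v ∈ V, Φ (x * v) = Φ x := setIntegral_right_invariant hVo ψ 1
  have hΦc : Continuous Φ := continuous_of_right_invariant hVo hΦV
  have hΦC : ∀ x, ‖Φ x‖ ≤ 1 * μ.real V := fun x => norm_setIntegral_le hVc fun v => hψ.norm_le _
  have hμ0 : μ.real V ≠ 0 := by
    rw [Measure.real, ENNReal.toReal_ne_zero]
    exact ⟨(hVo.measure_pos μ ⟨1, V.one_mem⟩).ne', hVc.measure_lt_top.ne⟩
  have hΦ1 : ∀ u ∈ V, Φ u = μ.real V := by
    intro u hu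
    have h1 := hΦV 1 u hu
    rw [one_mul] at h1
    rw [h1]
    have h2 : ∫ v in V, ψ (1 * v * 1) ∂μ = ∫ v in V, (1 : ℂ) ∂μ :=
      setIntegral_congr_fun hVo.measurableSet fun v hv => by simpa using hψN v (hVN hv)
    change ∫ v in V, ψ (1 * v * 1) ∂μ = _
    rw [h2]
    simp only [integral_const, MeasurableSet.univ, measureReal_restrict_apply, Set.univ_inter,
      Complex.real_smul, mul_one]
  set φ : G → ℂ := fun x => ∫ u in V, Φ (u * x) ∂μ with hφ
  have hφV : ∀ x, ∀ v ∈ V, φ (x * v) = φ x := by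
    intro x v hv
    simp only [hφ, ← mul_assoc, hΦV _ v hv]
  have hφC : ∀ x, ‖φ x‖ ≤ 1 * μ.real V * μ.real V := fun x => norm_setIntegral_le hVc fun v => hΦC _
  have hφ1 : φ 1 ≠ 0 := by
    have h2 : φ 1 = ∫ u in V, (μ.real V : ℂ) ∂μ :=
      setIntegral_congr_fun hVo.measurableSet fun v hv => by simpa using hΦ1 v hv
    rw [h2]
    simp only [integral_const, MeasurableSet.univ, measureReal_restrict_apply, Set.univ_inter,
      Complex.real_smul]
    exact_mod_cast mul_ne_zero hμ0 hμ0
  have hz : ∀ p, ‖(χ p)⁻¹‖ = 1 := fun p => by rw [norm_inv, hχ1, inv_one]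
  have hθe : ∀ t, IsEquivariant χ fun x => ∫ g in V, Φ (x * g * t) ∂μ := fun t => hΦe.integral V t
  have hθV : ∀ t x, ∀ v ∈ V, ∫ g in V, Φ (x * v * g * t) ∂μ = ∫ g in V, Φ (x * g * t) ∂μ :=
    fun t => setIntegral_right_invariant hVo Φ t
  have hθc : ∀ t, Continuous fun x => ∫ g in V, Φ (x * g * t) ∂μ := fun t =>
    continuous_of_right_invariant hVo (hθV t)
  have hθC : ∀ t x, ‖∫ g in V, Φ (x * g * t) ∂μ‖ ≤ 1 * μ.real V * μ.real V := fun t x =>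
    norm_setIntegral_le hVc fun g => hΦC _
  have hmain : ∀ {z : ℂ}, ‖z‖ = 1 → ∀ (g : G) (s t : G) (L : G → ℂ) (c : Ω),
      (∀ x : G, x⁻¹ • b ≠ c → Tendsto (fun n : ℕ => z ^ n * ∫ g' in V, Φ (x * g ^ n * g' * t) ∂μ)
        atTop (𝓝 (L x))) →
      Tendsto (fun n : ℕ => z ^ n * ∫ k in V, ∫ g' in V, φ (s * k * g ^ n * g' * t) ∂μ ∂μ) atTop
        (𝓝 (∫ u in V, ∫ k in V, L (u * s * k) ∂μ ∂μ)) := by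
    intro z hz g s t L c hL
    have := tendsto_double_integral (μ := μ) hVc hVc
      (F := fun n u k => z ^ n * ∫ g' in V, Φ (u * s * k * g ^ n * g' * t) ∂μ)
      (L := fun u k => L (u * s * k)) (C := 1 * μ.real V * μ.real V)
      (fun n => continuous_const.mul ((hθc t).comp (f := fun p : G × G => p.1 * s * p.2 * g ^ n)
        (by fun_prop)))
      (fun n u k => by rw [norm_mul, norm_pow, hz, one_pow, one_mul]; exact hθC t _)
      (fun u => by
        filter_upwards [ae_smul_ne (μ := μ) (b := b) (u * s) c] with k hk
        exact hL _ hk)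
    refine this.congr fun n => ?_
    simp only [hφ]
    rw [integral_average_eq hVo hVc hΦc hΦC s (g ^ n) t]
    simp only [integral_const_mul]
  refine not_isWienerGroup_of_kernel hbasis (φ := φ) (continuous_of_right_invariant hVo hφV) hφC hφ1
    (fun V' hVo' hVc' => exists_finiteDimensional_average hVo hVc hΦe hΦV hΦC hVo' hVc')
    hVo hVc h (z := (χ ⟨h, H.fix_b⟩)⁻¹) (z' := (χ ⟨k₀⁻¹ * h⁻¹ * k₀, H'.fix_b⟩)⁻¹) (d := 1)
    one_ne_zero (hz _) (hz _) ?_ hD ?_ ?_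
  · rw [← mul_inv, hχ]
    norm_num
  · intro s t
    have := hmain (hz ⟨h, H.fix_b⟩) h s t (fun x => φ t * ψ x) a (fun x hx => by
      have := H.tendsto_mul hUo (hχU U hUo hUc) hψ (hθe t) hVo (hθV t) hx
      simpa only [one_mul] using this)
    convert this using 2
    simp only [integral_const_mul, one_mul]
    rw [mul_comm]
    simp only [hφ, hΦ, mul_one]
  · intro s t
    have hlim : ∀ x : G, ∃ l, x⁻¹ • b ≠ b → Tendsto (fun n : ℕ =>
        (χ ⟨k₀⁻¹ * h⁻¹ * k₀, H'.fix_b⟩)⁻¹ ^ n * ∫ g' in V, Φ (x * h⁻¹ ^ n * g' * t) ∂μ)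
        atTop (𝓝 l) := by
      intro x
      by_cases hx : x⁻¹ • b = b
      · exact ⟨0, fun h => absurd hx h⟩
      · have Hi := H.inv
        rw [← hk₀] at Hi
        obtain ⟨l, hl⟩ := exists_tendsto_of_eventually_mul (hχ0 _)
          (u := fun n : ℕ => ∫ g' in V, Φ (x * h⁻¹ ^ n * g' * t) ∂μ)
          (Hi.eventually_apply_mul (hθe t) hVo (hθV t) H'.fix_b hx)
        exact ⟨l, fun _ => hl⟩
    choose L hL using hlim
    refine ⟨_, (hmain (hz ⟨k₀⁻¹ * h⁻¹ * k₀, H'.fix_b⟩) h⁻¹ s t L b hL).congr fun n => ?_⟩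
    simp only [inv_pow]

theorem not_isWienerGroup_of_dynamics (hbasis : HasCompactOpenBasis G)
    (hN : HasNorthSouth G Ω) {h : G} {E : Set Ω} (hE : IsClopen E)
    (hEE : ∀ x ∈ E, h • x ∈ E) {e : Ω} (he : e ∈ E) (he' : h⁻¹ • e ∉ E) : ¬ IsWienerGroup μ := by
  obtain ⟨a, b, H⟩ := exists_isHyperbolic hN hE hEE he he'
  rcases le_total (Measure.modularCharacterFun h) 1 with hD | hD
  · exact H.not_isWienerGroup_of_le_one hbasis hN hD
  · refine H.inv.not_isWienerGroup_of_le_one hbasis hN ?_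
    change Measure.modularCharacter h⁻¹ ≤ 1
    rw [map_inv]
    exact inv_le_one_of_one_le₀ hD

end Spherical

section PermutationTopology

variable {V : Type}

lemma isClosedEmbedding_perm : letI : TopologicalSpace V := ⊥
    IsClosedEmbedding fun φ : Equiv.Perm V => (⇑φ, ⇑φ.symm) := by
  let _ : TopologicalSpace V := ⊥
  have : DiscreteTopology V := ⟨rfl⟩
  refine ⟨⟨⟨rfl⟩, fun φ ψ h => Equiv.ext (congrFun (Prod.ext_iff.1 h).1)⟩, ?_⟩
  have : Set.range (fun φ : Equiv.Perm V => (⇑φ, ⇑φ.symm)) =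
      ⋂ v : V, {p : (V → V) × (V → V) | p.1 (p.2 v) = v} ∩ {p | p.2 (p.1 v) = v} := by
    ext p
    simp only [Set.mem_range, Set.mem_iInter, Set.mem_inter_iff, Set.mem_ofPred_eq]
    constructor
    · rintro ⟨φ, rfl⟩ v
      simp
    · intro h
      exact ⟨⟨p.1, p.2, fun v => (h v).2, fun v => (h v).1⟩, rfl⟩
  rw [this]
  refine isClosed_iInter fun v => IsClosed.inter ?_ ?_
  · rw [← isOpen_compl_iff, isOpen_iff_mem_nhds]
    intro p hp
    have h1 : ∀ᶠ q : (V → V) × (V → V) in 𝓝 p, q.2 v = p.2 v :=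
      (((continuous_apply v).comp continuous_snd).tendsto p).eventually
        (by simp : ∀ᶠ y in 𝓝 (p.2 v), y = p.2 v)
    have h2 : ∀ᶠ q : (V → V) × (V → V) in 𝓝 p, q.1 (p.2 v) = p.1 (p.2 v) :=
      (((continuous_apply (p.2 v)).comp continuous_fst).tendsto p).eventually
        (by simp : ∀ᶠ y in 𝓝 (p.1 (p.2 v)), y = p.1 (p.2 v))
    filter_upwards [h1, h2] with q hq1 hq2
    simpa [hq1, hq2] using hp
  · rw [← isOpen_compl_iff, isOpen_iff_mem_nhds]
    intro p hp
    have h1 : ∀ᶠ q : (V → V) × (V → V) in 𝓝 p, q.1 v = p.1 v :=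
      (((continuous_apply v).comp continuous_fst).tendsto p).eventually
        (by simp : ∀ᶠ y in 𝓝 (p.1 v), y = p.1 v)
    have h2 : ∀ᶠ q : (V → V) × (V → V) in 𝓝 p, q.2 (p.1 v) = p.2 (p.1 v) :=
      (((continuous_apply (p.1 v)).comp continuous_snd).tendsto p).eventually
        (by simp : ∀ᶠ y in 𝓝 (p.2 (p.1 v)), y = p.2 (p.1 v))
    filter_upwards [h1, h2] with q hq1 hq2
    simpa [hq1, hq2] using hp

lemma isOpen_apply_eq (v w : V) : IsOpen {φ : Equiv.Perm V | φ v = w} := by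
  let _ : TopologicalSpace V := ⊥
  have : DiscreteTopology V := ⟨rfl⟩
  exact (isOpen_discrete {w}).preimage
    (((continuous_apply v).comp continuous_fst).comp isClosedEmbedding_perm.continuous)

lemma isOpen_symm_apply_eq (v w : V) : IsOpen {φ : Equiv.Perm V | φ.symm v = w} := by
  convert isOpen_apply_eq w v using 1
  ext φ
  exact φ.symm_apply_eq.trans eq_comm

lemma continuous_perm_iff {Y : Type*} [TopologicalSpace Y] {f : Y → Equiv.Perm V} :
    Continuous f ↔ ∀ v w, IsOpen {y | f y v = w} := by
  refine ⟨fun hf v w => (isOpen_apply_eq v w).preimage hf, fun h => ?_⟩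
  let _ : TopologicalSpace V := ⊥
  have : DiscreteTopology V := ⟨rfl⟩
  rw [isClosedEmbedding_perm.isInducing.continuous_iff]
  refine (continuous_pi fun v => ?_).prodMk (continuous_pi fun v => ?_)
  · exact continuous_discrete_rng.2 fun w => h v w
  · refine continuous_discrete_rng.2 fun w => ?_
    convert h w v using 1
    ext y
    exact (f y).symm_apply_eq.trans eq_comm

instance : IsTopologicalGroup (Equiv.Perm V) where
  continuous_mul := continuous_perm_iff.2 fun v w => by
    have : {p : Equiv.Perm V × Equiv.Perm V | (p.1 * p.2) v = w} =
        ⋃ u, {φ : Equiv.Perm V | φ u = w} ×ˢ {φ : Equiv.Perm V | φ v = u} := by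
      ext p; simp
    rw [this]
    exact isOpen_iUnion fun u => (isOpen_apply_eq u w).prod (isOpen_apply_eq v u)
  continuous_inv := continuous_perm_iff.2 fun v w => isOpen_symm_apply_eq v w

instance : T2Space (Equiv.Perm V) := by
  let _ : TopologicalSpace V := ⊥
  have : DiscreteTopology V := ⟨rfl⟩
  exact isClosedEmbedding_perm.isEmbedding.t2Space

instance [Countable V] : SecondCountableTopology (Equiv.Perm V) := by
  let _ : TopologicalSpace V := ⊥
  have : DiscreteTopology V := ⟨rfl⟩
  exact isClosedEmbedding_perm.isEmbedding.secondCountableTopology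

lemma isCompact_of_finite_orbits {S : Set (Equiv.Perm V)} (hS : IsClosed S)
    (h1 : ∀ v, {w | ∃ φ ∈ S, φ v = w}.Finite) (h2 : ∀ v, {w | ∃ φ ∈ S, φ.symm v = w}.Finite) :
    IsCompact S := by
  let _ : TopologicalSpace V := ⊥
  have : DiscreteTopology V := ⟨rfl⟩
  refine (isClosedEmbedding_perm.isCompact_preimage
    ((isCompact_univ_pi fun v => (h1 v).isCompact).prod
      (isCompact_univ_pi fun v => (h2 v).isCompact))).of_isClosed_subset hS ?_
  intro φ hφ
  exact ⟨fun v _ => ⟨φ, hφ, rfl⟩, fun v _ => ⟨φ, hφ, rfl⟩⟩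

lemma exists_finset_of_mem_nhds_one {U : Set (Equiv.Perm V)} (hU : U ∈ 𝓝 1) :
    ∃ A : Finset V, ∀ φ : Equiv.Perm V, (∀ v ∈ A, φ v = v) → φ ∈ U := by
  classical
  let _ : TopologicalSpace V := ⊥
  have : DiscreteTopology V := ⟨rfl⟩
  rw [isClosedEmbedding_perm.isInducing.nhds_eq_comap, mem_comap] at hU
  obtain ⟨T, hT, hTU⟩ := hU
  rw [nhds_prod_eq, Filter.mem_prod_iff] at hT
  obtain ⟨T₁, hT₁, T₂, hT₂, hT⟩ := hT
  rw [nhds_pi, Filter.mem_pi] at hT₁ hT₂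
  obtain ⟨I₁, hI₁, t₁, ht₁, hs₁⟩ := hT₁
  obtain ⟨I₂, hI₂, t₂, ht₂, hs₂⟩ := hT₂
  refine ⟨hI₁.toFinset ∪ hI₂.toFinset, fun φ hφ => hTU (hT ⟨hs₁ fun v hv => ?_, hs₂ fun v hv => ?_⟩)⟩
  · have := mem_of_mem_nhds (ht₁ v)
    simp only [hφ v (by simp [hv])]
    exact this
  · have := mem_of_mem_nhds (ht₂ v)
    simp only [φ.symm_apply_eq.2 (hφ v (by simp [hv])).symm]
    exact this

end PermutationTopology

section GraphAutomorphisms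

variable {V : Type} {X : SimpleGraph V}

/-- Every element of `Γ` is an automorphism of `X`. -/
class ActsByAut (X : SimpleGraph V) (Γ : Subgroup (Equiv.Perm V)) : Prop where
  adj_iff : ∀ φ ∈ Γ, ∀ u v, X.Adj (φ u) (φ v) ↔ X.Adj u v

/-- Every vertex of `X` has finitely many neighbours. -/
class FiniteNeighbors (X : SimpleGraph V) : Prop where
  finite : ∀ v, (X.neighborSet v).Finite

lemma induction_adj (hX : X.Connected) {p : V → Prop} {b : V} (hb : p b)
    (h : ∀ u v, X.Adj u v → p u → p v) (v : V) : p v := by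
  obtain ⟨w⟩ := hX.preconnected b v
  induction w with
  | nil => exact hb
  | cons a _ ih => exact ih (h _ _ a hb)

lemma countable_of_connected [FiniteNeighbors X] (hX : X.Connected) : Countable V := by
  obtain ⟨b⟩ := hX.nonempty
  let B : ℕ → Set V := fun n => Nat.rec {b} (fun _ S => ⋃ v ∈ S, X.neighborSet v) n
  have hB : ∀ n, (B n).Finite := by
    intro n
    induction n with
    | zero => exact Set.finite_singleton b
    | succ n ih => exact ih.biUnion fun v _ => FiniteNeighbors.finite v
  have hU : ∀ v, v ∈ ⋃ n, B n := by
    refine induction_adj hX (b := b) (Set.mem_iUnion.2 ⟨0, rfl⟩) fun u v huv hu => ?_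
    obtain ⟨n, hn⟩ := Set.mem_iUnion.1 hu
    exact Set.mem_iUnion.2 ⟨n + 1, Set.mem_biUnion hn huv⟩
  rw [← Set.countable_univ_iff, ← Set.eq_univ_of_forall hU]
  exact Set.countable_iUnion fun n => (hB n).countable

variable {Γ : Subgroup (Equiv.Perm V)}

lemma finite_orbit_of_finite [FiniteNeighbors X] (hX : X.Connected) {S : Set (Equiv.Perm V)}
    (hS : ∀ φ ∈ S, ∀ u v, X.Adj (φ u) (φ v) ↔ X.Adj u v) {b : V}
    (hb : {w | ∃ φ ∈ S, φ b = w}.Finite) (v : V) : {w | ∃ φ ∈ S, φ v = w}.Finite := by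
  refine induction_adj hX (p := fun v => {w | ∃ φ ∈ S, φ v = w}.Finite) hb (fun u v huv hu => ?_) v
  refine (hu.biUnion fun w _ => FiniteNeighbors.finite (X := X) w).subset ?_
  rintro _ ⟨φ, hφ, rfl⟩
  exact Set.mem_biUnion ⟨φ, hφ, rfl⟩ ((hS φ hφ u v).2 huv)

lemma isCompact_apply_eq [FiniteNeighbors X] (hX : X.Connected) [ActsByAut X Γ]
    (hΓ : IsClosed (Γ : Set (Equiv.Perm V))) (b c : V) :
    IsCompact {g : Γ | (g : Equiv.Perm V) b = c} := by
  have hcl : IsClosed {φ : Equiv.Perm V | φ b = c} := by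
    have : {φ : Equiv.Perm V | φ b = c} = (⋃ w ∈ ({c} : Set V)ᶜ, {φ : Equiv.Perm V | φ b = w})ᶜ := by
      ext φ
      simp only [Set.mem_ofPred_eq, Set.mem_compl_iff, Set.mem_iUnion, Set.mem_singleton_iff,
        exists_prop, not_exists, not_and]
      exact ⟨fun h i hi h' => hi (h'.symm.trans h), fun h => by_contra fun h' => h _ h' rfl⟩
    rw [this]
    exact (isOpen_biUnion fun w _ => isOpen_apply_eq b w).isClosed_compl
  have hS : IsCompact ((Γ : Set (Equiv.Perm V)) ∩ {φ | φ b = c}) := by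
    refine isCompact_of_finite_orbits (hΓ.inter hcl) (finite_orbit_of_finite hX (b := b)
      (fun φ hφ => ActsByAut.adj_iff φ hφ.1) ((Set.finite_singleton c).subset ?_)) fun v => ?_
    · rintro _ ⟨φ, hφ, rfl⟩
      exact hφ.2
    · refine (finite_orbit_of_finite hX (b := c)
        (S := {ψ | ψ.symm ∈ (Γ : Set (Equiv.Perm V)) ∩ {φ | φ b = c}}) ?_
        ((Set.finite_singleton b).subset ?_) v).subset ?_
      · intro φ hφ u v
        simpa using (ActsByAut.adj_iff (X := X) _ hφ.1 (φ u) (φ v)).symm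
      · rintro _ ⟨φ, hφ, rfl⟩
        exact (φ.symm_apply_eq.1 hφ.2).symm
      · rintro _ ⟨φ, hφ, rfl⟩
        exact ⟨φ.symm, by simpa using hφ, rfl⟩
  have h := hΓ.isClosedEmbedding_subtypeVal.isCompact_preimage hS
  have e : {g : Γ | (g : Equiv.Perm V) b = c} =
      Subtype.val ⁻¹' ((Γ : Set (Equiv.Perm V)) ∩ {φ | φ b = c}) := by
    ext g
    simp
  rw [e]
  exact h

lemma isCompact_meets [FiniteNeighbors X] (hX : X.Connected) [ActsByAut X Γ]
    (hΓ : IsClosed (Γ : Set (Equiv.Perm V))) (A B : Finset V) :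
    IsCompact {g : Γ | ∃ a ∈ A, (g : Equiv.Perm V) a ∈ B} := by
  have : {g : Γ | ∃ a ∈ A, (g : Equiv.Perm V) a ∈ B} =
      ⋃ a ∈ A, ⋃ b ∈ B, {g : Γ | (g : Equiv.Perm V) a = b} := by
    ext g
    simp
  rw [this]
  exact A.isCompact_biUnion fun a _ => B.isCompact_biUnion fun b _ => isCompact_apply_eq hX hΓ a b

lemma isOpen_coe_apply_eq (b c : V) : IsOpen {g : Γ | (g : Equiv.Perm V) b = c} :=
  (isOpen_apply_eq b c).preimage continuous_subtype_val

/-- The pointwise stabilizer of a set of vertices. -/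
def pointwiseStabilizer (Γ : Subgroup (Equiv.Perm V)) (A : Finset V) : Subgroup Γ where
  carrier := {g | ∀ v ∈ A, (g : Equiv.Perm V) v = v}
  mul_mem' {g h} hg hh v hv := by simp [hh v hv, hg v hv]
  one_mem' v _ := by simp
  inv_mem' {g} hg v hv := by simpa using (Equiv.symm_apply_eq _).2 (hg v hv).symm

lemma isOpen_pointwiseStabilizer (A : Finset V) :
    IsOpen (pointwiseStabilizer Γ A : Set Γ) := by
  have : (pointwiseStabilizer Γ A : Set Γ) = ⋂ v ∈ A, {g : Γ | (g : Equiv.Perm V) v = v} := by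
    ext g
    simp only [Set.mem_iInter]
    rfl
  rw [this]
  exact isOpen_biInter_finset fun v _ => isOpen_coe_apply_eq v v

lemma hasCompactOpenBasis [DecidableEq V] [FiniteNeighbors X] (hX : X.Connected) [ActsByAut X Γ]
    (hΓ : IsClosed (Γ : Set (Equiv.Perm V))) : HasCompactOpenBasis Γ := by
  intro U hU
  obtain ⟨b⟩ := hX.nonempty
  rw [nhds_subtype_eq_comap, mem_comap] at hU
  obtain ⟨T, hT, hTU⟩ := hU
  obtain ⟨A, hA⟩ := exists_finset_of_mem_nhds_one hT
  refine ⟨pointwiseStabilizer Γ (insert b A), isOpen_pointwiseStabilizer _,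
    (isCompact_apply_eq hX hΓ b b).of_isClosed_subset
      (Subgroup.isClosed_of_isOpen _ (isOpen_pointwiseStabilizer _))
      fun g hg => hg b (Finset.mem_insert_self b A),
    fun g hg => hTU (hA _ fun v hv => hg v (Finset.mem_insert_of_mem hv))⟩

lemma locallyCompactSpace [FiniteNeighbors X] (hX : X.Connected) [ActsByAut X Γ]
    (hΓ : IsClosed (Γ : Set (Equiv.Perm V))) : LocallyCompactSpace Γ := by
  obtain ⟨b⟩ := hX.nonempty
  exact (isCompact_apply_eq hX hΓ b b).locallyCompactSpace_of_mem_nhds_of_group (x := 1)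
    ((isOpen_coe_apply_eq b b).mem_nhds (by simp))

end GraphAutomorphisms

section Ends

variable {V : Type} {X : SimpleGraph V}

/-- The space of ends of a graph. -/
def Boundary (X : SimpleGraph V) : Type := X.end

/-- The component of the complement of `K` in which the end `x` lies. -/
def Boundary.comp (x : Boundary X) (K : Finset V) : X.ComponentCompl (K : Set V) :=
  x.1 (Opposite.op K)

/-- The vertices of the component of the complement of `K` in which the end `x` lies. -/
def Boundary.side (x : Boundary X) (K : Finset V) : Set V := (x.comp K).supp

namespace Boundary

lemma comp_hom (x : Boundary X) {K L : Finset V} (h : K ⊆ L) :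
    (x.comp L).hom (Finset.coe_subset.2 h) = x.comp K :=
  x.2 (CategoryTheory.opHomOfLE h)

lemma side_anti (x : Boundary X) {K L : Finset V} (h : K ⊆ L) : x.side L ⊆ x.side K :=
  ((x.comp L).hom_eq_iff_le _ _).1 (x.comp_hom h)

lemma side_nonempty (x : Boundary X) (K : Finset V) : (x.side K).Nonempty :=
  (x.comp K).nonempty

lemma notMem_of_mem_side {x : Boundary X} {K : Finset V} {v : V} (h : v ∈ x.side K) : v ∉ K :=
  fun hv => (x.comp K).notMem_of_mem h hv

lemma comp_eq_of_mem {x y : Boundary X} {K : Finset V} {v : V} (hx : v ∈ x.side K)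
    (hy : v ∈ y.side K) : x.comp K = y.comp K :=
  hx.choose_spec.symm.trans hy.choose_spec

lemma side_eq_of_mem {x y : Boundary X} {K : Finset V} {v : V} (hx : v ∈ x.side K)
    (hy : v ∈ y.side K) : x.side K = y.side K :=
  congrArg _ (comp_eq_of_mem hx hy)

lemma mem_side_iff {x : Boundary X} {K : Finset V} {v : V} (hv : v ∉ (K : Set V)) :
    v ∈ x.side K ↔ x.comp K = X.componentComplMk hv :=
  ⟨fun h => h.choose_spec.symm, fun h => ⟨hv, h.symm⟩⟩

lemma ext_side {x y : Boundary X} (h : ∀ K, ∃ v, v ∈ x.side K ∧ v ∈ y.side K) : x = y :=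
  Subtype.ext <| funext fun K => comp_eq_of_mem (h K.unop).choose_spec.1 (h K.unop).choose_spec.2

lemma exists_side_ne {x y : Boundary X} (h : x ≠ y) : ∃ K, x.side K ≠ y.side K := by
  by_contra! H
  refine h (ext_side fun K => ?_)
  obtain ⟨v, hv⟩ := x.side_nonempty K
  exact ⟨v, hv, H K ▸ hv⟩

/-- The end given by a consistent choice of components. -/
def ofComp (c : ∀ K : Finset V, X.ComponentCompl (K : Set V))
    (hc : ∀ K L : Finset V, K ⊆ L → ∃ v, v ∈ (c L).supp ∧ v ∈ (c K).supp) : Boundary X :=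
  ⟨fun K => c K.unop, fun {L _} f =>
    ((c L.unop).hom_eq_iff_not_disjoint
      (Finset.coe_subset.2 (CategoryTheory.le_of_op_hom f)) _).2
      (Set.not_disjoint_iff.2 (hc _ _ (CategoryTheory.le_of_op_hom f)))⟩

instance : TopologicalSpace (Boundary X) :=
  letI : ∀ K, TopologicalSpace (X.componentComplFunctor.obj K) := fun _ => ⊥
  inferInstanceAs (TopologicalSpace X.end)

lemma continuous_iff {Y : Type*} [TopologicalSpace Y] {f : Y → Boundary X} :
    Continuous f ↔ ∀ K v, IsOpen {y | v ∈ (f y).side K} := by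
  let _ : ∀ K, TopologicalSpace (X.componentComplFunctor.obj K) := fun _ => ⊥
  have : ∀ K, DiscreteTopology (X.componentComplFunctor.obj K) := fun _ => ⟨rfl⟩
  have h1 : Continuous f ↔ Continuous fun y => (f y).1 := continuous_induced_rng
  rw [h1, continuous_pi_iff]
  constructor
  · intro h K v
    exact (isOpen_discrete {C : X.componentComplFunctor.obj (Opposite.op K) |
      v ∈ SimpleGraph.ComponentCompl.supp C}).preimage (h (Opposite.op K))
  · intro h K
    refine continuous_discrete_rng.2 fun C => ?_
    obtain ⟨v, hv, rfl⟩ := SimpleGraph.ComponentCompl.exists_eq_mk C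
    convert h K.unop v using 1
    ext y
    exact (mem_side_iff hv).symm

lemma isOpen_mem_side (K : Finset V) (v : V) : IsOpen {x : Boundary X | v ∈ x.side K} :=
  continuous_iff.1 continuous_id K v

lemma isOpen_side_eq (K : Finset V) (S : Set V) : IsOpen {x : Boundary X | x.side K = S} := by
  rw [isOpen_iff_mem_nhds]
  intro x hx
  obtain ⟨v, hv⟩ := x.side_nonempty K
  filter_upwards [(isOpen_mem_side K v).mem_nhds hv] with y hy
  exact (side_eq_of_mem hy hv).trans hx

lemma isClopen_side_eq (K : Finset V) (S : Set V) : IsClopen {x : Boundary X | x.side K = S} := by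
  refine ⟨⟨?_⟩, isOpen_side_eq K S⟩
  rw [isOpen_iff_mem_nhds]
  intro x hx
  filter_upwards [(isOpen_side_eq K (x.side K)).mem_nhds rfl] with y hy
  exact fun h => hx (hy.symm.trans h)

instance : TotallyDisconnectedSpace (Boundary X) := by
  let _ : ∀ K, TopologicalSpace (X.componentComplFunctor.obj K) := fun _ => ⊥
  have : ∀ K, DiscreteTopology (X.componentComplFunctor.obj K) := fun _ => ⟨rfl⟩
  exact inferInstanceAs (TotallyDisconnectedSpace X.end)

instance : T2Space (Boundary X) := by
  let _ : ∀ K, TopologicalSpace (X.componentComplFunctor.obj K) := fun _ => ⊥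
  have : ∀ K, DiscreteTopology (X.componentComplFunctor.obj K) := fun _ => ⟨rfl⟩
  exact inferInstanceAs (T2Space X.end)

lemma finite_componentCompl [FiniteNeighbors X] (hX : X.Connected) (K : Finset V) :
    Finite (X.ComponentCompl (K : Set V)) := by
  have : X.LocallyFinite := fun v => (FiniteNeighbors.finite v).fintype
  have : Fact X.Preconnected := ⟨hX.preconnected⟩
  infer_instance

lemma compactSpace [FiniteNeighbors X] (hX : X.Connected) : CompactSpace (Boundary X) := by
  let _ : ∀ K, TopologicalSpace (X.componentComplFunctor.obj K) := fun _ => ⊥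
  have : ∀ K, DiscreteTopology (X.componentComplFunctor.obj K) := fun _ => ⟨rfl⟩
  have : ∀ K, Finite (X.componentComplFunctor.obj K) := fun K => finite_componentCompl hX K.unop
  have hcl : IsClosed X.end := by
    have : X.end = ⋂ (K) (L) (f : K ⟶ L), {s | X.componentComplFunctor.map f (s K) = s L} := by
      ext s
      simp only [Set.mem_iInter]
      exact ⟨fun h K L f => h f, fun h K L f => h K L f⟩
    rw [this]
    refine isClosed_iInter fun K => isClosed_iInter fun L => isClosed_iInter fun f => ?_
    exact isClosed_eq (continuous_of_discreteTopology.comp (continuous_apply K)) (continuous_apply L)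
  exact isCompact_iff_compactSpace.1 hcl.isCompact

lemma exists_side_saturated [DecidableEq V] [FiniteNeighbors X] (hX : X.Connected)
    {E : Set (Boundary X)} (hE : IsClopen E) :
    ∃ K : Finset V, ∀ x y : Boundary X, x.side K = y.side K → (x ∈ E ↔ y ∈ E) := by
  have := compactSpace hX
  let U : Finset V → Set (Boundary X × Boundary X) := fun K => {p | p.1.side K = p.2.side K}
  have hU : ∀ K, IsClosed (U K) := by
    intro K
    rw [← isOpen_compl_iff, isOpen_iff_mem_nhds]
    intro p hp
    filter_upwards [prod_mem_nhds ((isOpen_side_eq K (p.1.side K)).mem_nhds rfl)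
      ((isOpen_side_eq K (p.2.side K)).mem_nhds rfl)] with q hq h
    exact hp (hq.1.symm.trans (h.trans hq.2))
  have hE' : IsOpen {p : Boundary X × Boundary X | p.1 ∈ E ↔ p.2 ∈ E} := by
    have : {p : Boundary X × Boundary X | p.1 ∈ E ↔ p.2 ∈ E} = E ×ˢ E ∪ Eᶜ ×ˢ Eᶜ := by
      ext p
      simp only [Set.mem_ofPred_eq, Set.mem_union, Set.mem_prod, Set.mem_compl_iff]
      tauto
    rw [this]
    exact (hE.isOpen.prod hE.isOpen).union (hE.compl.isOpen.prod hE.compl.isOpen)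
  have hmono : ∀ K L, K ⊆ L → U L ⊆ U K := by
    rintro K L h p (hp : _ = _)
    obtain ⟨v, hv⟩ := p.1.side_nonempty L
    exact side_eq_of_mem (p.1.side_anti h hv) (p.2.side_anti h (hp ▸ hv))
  have hdir : Directed (· ⊇ ·) U := fun K L =>
    ⟨K ∪ L, hmono _ _ Finset.subset_union_left, hmono _ _ Finset.subset_union_right⟩
  obtain ⟨K, hK⟩ := exists_subset_nhds_of_isCompact
    (U := {p : Boundary X × Boundary X | p.1 ∈ E ↔ p.2 ∈ E}) hdir
    (fun K => (hU K).isCompact) fun p hp => by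
      have : p.1 = p.2 := by
        by_contra h
        obtain ⟨K, hK⟩ := exists_side_ne h
        exact hK (Set.mem_iInter.1 hp K)
      exact hE'.mem_nhds (by simp [this])
  exact ⟨K, fun x y h => hK (show (x, y) ∈ U K from h)⟩

end Boundary

end Ends

section EndAction

variable {V : Type} {X : SimpleGraph V} {Γ : Subgroup (Equiv.Perm V)}

lemma subset_of_induce_preconnected {T S : Set V} (hT : (X.induce T).Preconnected) {v : V}
    (hv : v ∈ T) (hvS : v ∈ S) (h : ∀ u ∈ T, ∀ w ∈ T, X.Adj u w → u ∈ S → w ∈ S) : T ⊆ S := by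
  intro w hw
  obtain ⟨p⟩ := hT ⟨v, hv⟩ ⟨w, hw⟩
  generalize ha : (⟨v, hv⟩ : T) = a at p
  generalize hb : (⟨w, hw⟩ : T) = b at p
  have haS : (a : V) ∈ S := ha ▸ hvS
  have : (b : V) ∈ S := by
    clear ha hb
    induction p with
    | nil => exact haS
    | cons e _ ih => exact ih (h _ (Subtype.prop _) _ (Subtype.prop _) e haS)
  rw [← hb] at this
  exact this

lemma supp_subset {K : Set V} (C : X.ComponentCompl K) {S : Set V} {v : V} (hv : v ∈ C.supp)
    (hvS : v ∈ S) (h : ∀ u ∈ C.supp, ∀ w ∈ C.supp, X.Adj u w → u ∈ S → w ∈ S) : C.supp ⊆ S := by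
  rintro w ⟨hw, hwC⟩
  obtain ⟨hv', hvC⟩ := hv
  obtain ⟨p⟩ := SimpleGraph.ConnectedComponent.exact (hvC.trans hwC.symm)
  generalize hb : (⟨w, hw⟩ : (Kᶜ : Set V)) = b at p
  have : (b : V) ∈ S := by
    clear hwC
    generalize ha : (⟨v, hv'⟩ : (Kᶜ : Set V)) = a at p
    have haS : (a : V) ∈ S := ha ▸ hvS
    have haC : (a : V) ∈ C.supp := ha ▸ ⟨hv', hvC⟩
    clear ha hb
    induction p with
    | nil => exact haS
    | @cons x y _ e _ ih =>
      have hy : (y : V) ∈ C.supp := SimpleGraph.ComponentCompl.mem_of_adj _ _ haC y.2 e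
      exact ih (h _ haC _ hy e haS) hy
  rw [← hb] at this
  exact this

namespace Boundary

variable [DecidableEq V] [ActsByAut X Γ]

lemma smul_notMem (g : Γ) {K : Finset V} {v : V} {x : Boundary X}
    (hv : v ∈ x.side (K.image (g : Equiv.Perm V).symm)) : (g : Equiv.Perm V) v ∉ (K : Set V) :=
  fun h => notMem_of_mem_side hv (Finset.mem_image.2 ⟨_, h, by simp⟩)

/-- The image of an end under an automorphism, at the level of components. -/
def smulComp (g : Γ) (x : Boundary X) (K : Finset V) : X.ComponentCompl (K : Set V) :=
  X.componentComplMk (smul_notMem g (x.side_nonempty (K.image (g : Equiv.Perm V).symm)).some_mem)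

lemma apply_mem_smulComp (g : Γ) (x : Boundary X) (K : Finset V) {v : V}
    (hv : v ∈ x.side (K.image (g : Equiv.Perm V).symm)) :
    (g : Equiv.Perm V) v ∈ (smulComp g x K).supp := by
  refine supp_subset (x.comp (K.image (g : Equiv.Perm V).symm))
    (S := {u | (g : Equiv.Perm V) u ∈ (smulComp g x K).supp})
    (x.side_nonempty (K.image (g : Equiv.Perm V).symm)).some_mem
    (X.componentComplMk_mem _) (fun u hu w hw e hS => ?_) hv
  exact SimpleGraph.ComponentCompl.mem_of_adj _ _ hS (smul_notMem g hw)
    ((ActsByAut.adj_iff _ g.2 _ _).2 e)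

instance : SMul Γ (Boundary X) where
  smul g x := ofComp (smulComp g x) fun K L h => by
    obtain ⟨v, hv⟩ := x.side_nonempty (L.image (g : Equiv.Perm V).symm)
    exact ⟨_, apply_mem_smulComp g x L hv,
      apply_mem_smulComp g x K (x.side_anti (Finset.image_subset_image h) hv)⟩

lemma apply_mem_side_smul (g : Γ) {x : Boundary X} {K : Finset V} {v : V}
    (hv : v ∈ x.side (K.image (g : Equiv.Perm V).symm)) :
    (g : Equiv.Perm V) v ∈ (g • x).side K :=
  apply_mem_smulComp g x K hv

instance : MulAction Γ (Boundary X) where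
  one_smul x := ext_side fun K => by
    obtain ⟨v, hv⟩ := x.side_nonempty (K.image ((1 : Γ) : Equiv.Perm V).symm)
    exact ⟨v, apply_mem_side_smul 1 hv, Finset.image_id (s := K) ▸ hv⟩
  mul_smul g h x := ext_side fun K => by
    obtain ⟨v, hv⟩ := x.side_nonempty (K.image ((g * h : Γ) : Equiv.Perm V).symm)
    refine ⟨_, apply_mem_side_smul (g * h) hv, ?_⟩
    have e : K.image ((g * h : Γ) : Equiv.Perm V).symm =
        (K.image (g : Equiv.Perm V).symm).image (h : Equiv.Perm V).symm := by
      rw [Finset.image_image]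
      rfl
    rw [e] at hv
    exact apply_mem_side_smul g (apply_mem_side_smul h hv)

lemma mem_side_smul_iff (g : Γ) {x : Boundary X} {K : Finset V} {v : V} :
    v ∈ (g • x).side K ↔
      (g : Equiv.Perm V).symm v ∈ x.side (K.image (g : Equiv.Perm V).symm) := by
  constructor
  · intro h
    have e : K = (K.image (g : Equiv.Perm V).symm).image ((g⁻¹ : Γ) : Equiv.Perm V).symm := by
      rw [Finset.image_image]
      change K = K.image ((g : Equiv.Perm V) ∘ (g : Equiv.Perm V).symm)
      simp
    rw [e] at h
    have := apply_mem_side_smul g⁻¹ h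
    rwa [inv_smul_smul] at this
  · intro h
    simpa using apply_mem_side_smul g h

instance : ContinuousSMul Γ (Boundary X) where
  continuous_smul := continuous_iff.2 fun K v => by
    rw [isOpen_iff_mem_nhds]
    rintro ⟨g, x⟩ h
    have h' := (mem_side_smul_iff g).1 h
    have hO : IsOpen (⋂ w ∈ insert v K, {k : Γ |
        (k : Equiv.Perm V) ((g : Equiv.Perm V).symm w) = w}) :=
      isOpen_biInter_finset fun w _ => isOpen_coe_apply_eq _ _
    filter_upwards [prod_mem_nhds (hO.mem_nhds (by simp))
      ((isOpen_mem_side _ _).mem_nhds h')] with ⟨k, y⟩ ⟨hk, hy⟩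
    have hk' : ∀ w ∈ insert v K, (k : Equiv.Perm V).symm w = (g : Equiv.Perm V).symm w := by
      intro w hw
      rw [Equiv.symm_apply_eq]
      exact (Set.mem_iInter₂.1 hk w hw).symm
    refine (mem_side_smul_iff k).2 ?_
    rw [hk' v (Finset.mem_insert_self v K),
      Finset.image_congr fun w hw => hk' w (Finset.mem_insert_of_mem hw)]
    exact hy

lemma smul_eq_of_endMapsTo (g : Γ) (x y : Boundary X)
    (h : EndMapsTo X (g : Equiv.Perm V) x.1 y.1) : g • x = y := by
  refine ext_side fun K => ?_
  obtain ⟨v, hv⟩ := x.side_nonempty (K.image (g : Equiv.Perm V).symm)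
  exact ⟨_, apply_mem_side_smul g hv,
    (mem_side_iff (smul_notMem g hv)).2 (h K v hv (smul_notMem g hv))⟩

end Boundary

end EndAction

section EndDynamics

variable {V : Type} {X : SimpleGraph V} {Γ : Subgroup (Equiv.Perm V)}

namespace Boundary

variable [DecidableEq V] [ActsByAut X Γ]

lemma mem_side_of_adj {x : Boundary X} {K : Finset V} {u v : V} (hu : u ∈ x.side K) (hv : v ∉ K)
    (h : X.Adj u v) : v ∈ x.side K :=
  SimpleGraph.ComponentCompl.mem_of_adj (C := x.comp K) _ _ hu hv h

lemma apply_mem_side_smul_of_disjoint (hX : X.Connected) {B : Finset V}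
    (hB : (X.induce (B : Set V)).Preconnected) {b : V} (hb : b ∈ B) {g : Γ}
    (hg : ∀ a ∈ B, (g : Equiv.Perm V) a ∉ B) {x : Boundary X}
    (hx : (g : Equiv.Perm V).symm b ∉ x.side B) : (g : Equiv.Perm V) b ∈ (g • x).side B := by
  set y := g • x
  set L := B.image (g : Equiv.Perm V) with hL
  have hLB : ∀ a ∈ B, a ∉ L := by
    intro a ha haL
    obtain ⟨c, hc, rfl⟩ := Finset.mem_image.1 haL
    exact hg c hc ha
  have hby : b ∉ y.side L := by
    intro h
    rw [mem_side_smul_iff, hL, Finset.image_image] at h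
    simp only [Equiv.symm_comp_self, Finset.image_id] at h
    exact hx h
  have hBy : ∀ a ∈ B, a ∉ y.side L := fun a ha haL =>
    hby (subset_of_induce_preconnected hB ha haL
      (fun u _ w hw e hu => mem_side_of_adj hu (hLB w hw) e) hb)
  obtain ⟨w, hw⟩ := y.side_nonempty (B ∪ L)
  have hsub : y.side L ⊆ y.side B :=
    supp_subset (y.comp L) (y.side_anti Finset.subset_union_right hw)
      (y.side_anti Finset.subset_union_left hw)
      fun u _ w hw e hu => mem_side_of_adj hu (fun h => hBy w h hw) e
  obtain ⟨⟨c, k⟩, hc, hk, e⟩ := SimpleGraph.ComponentCompl.exists_adj_boundary_pair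
    hX.preconnected (K := (L : Set V)) ⟨_, Finset.mem_image_of_mem _ hb⟩ (y.comp L)
  obtain ⟨a, ha, rfl⟩ := Finset.mem_image.1 (Finset.mem_coe.1 hk)
  exact subset_of_induce_preconnected hB ha (S := {v | (g : Equiv.Perm V) v ∈ y.side B})
    (mem_side_of_adj (hsub hc) (hg a ha) e)
    (fun u _ w hw e hu => mem_side_of_adj hu (hg w hw) ((ActsByAut.adj_iff _ g.2 _ _).2 e)) hb

lemma side_eq_of_subset {x y : Boundary X} {K L : Finset V} (h : K ⊆ L)
    (hxy : x.side L = y.side L) : x.side K = y.side K := by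
  obtain ⟨v, hv⟩ := x.side_nonempty L
  exact side_eq_of_mem (x.side_anti h hv) (y.side_anti h (hxy ▸ hv))

lemma hasNorthSouth [FiniteNeighbors X] (hX : X.Connected)
    (hΓ : IsClosed (Γ : Set (Equiv.Perm V))) : HasNorthSouth Γ (Boundary X) := by
  intro E F hE hF
  obtain ⟨K₁, hK₁⟩ := exists_side_saturated hX hE
  obtain ⟨K₂, hK₂⟩ := exists_side_saturated hX hF
  obtain ⟨b⟩ := hX.nonempty
  obtain ⟨B, hKB, hB⟩ := SimpleGraph.extend_finset_to_connected hX.preconnected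
    (t := insert b (K₁ ∪ K₂)) (Finset.insert_nonempty _ _)
  have hb : b ∈ B := hKB (Finset.mem_insert_self _ _)
  have h1 : K₁ ⊆ B :=
    (Finset.subset_union_left.trans (Finset.subset_insert _ _)).trans hKB
  have h2 : K₂ ⊆ B :=
    (Finset.subset_union_right.trans (Finset.subset_insert _ _)).trans hKB
  have hE' : ∀ x y v, v ∈ x.side B → v ∈ y.side B → x ∈ E → y ∈ E := fun x y v hx hy h =>
    (hK₁ x y (side_eq_of_subset h1 (side_eq_of_mem hx hy))).1 h
  have hF' : ∀ x y v, v ∈ x.side B → v ∈ y.side B → x ∈ F → y ∈ F := fun x y v hx hy h =>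
    (hK₂ x y (side_eq_of_subset h2 (side_eq_of_mem hx hy))).1 h
  refine ⟨_, isCompact_meets hX hΓ B B, fun g hg => ?_⟩
  have hg' : ∀ a ∈ B, (g : Equiv.Perm V) a ∉ B := fun a ha h => hg ⟨a, ha, h⟩
  have key := fun x => apply_mem_side_smul_of_disjoint hX hB.preconnected hb hg' (x := x)
  have hP : (∀ y : Boundary X, (g : Equiv.Perm V) b ∈ y.side B → y ∈ F) ∨
      ∀ y : Boundary X, (g : Equiv.Perm V) b ∈ y.side B → y ∉ F := by
    by_contra! h
    obtain ⟨⟨y, hy, hyF⟩, z, hz, hzF⟩ := h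
    exact hyF (hF' z y _ hz hy hzF)
  by_cases hD : ∃ x ∈ E, (g : Equiv.Perm V).symm b ∈ x.side B
  · obtain ⟨z, hzE, hz⟩ := hD
    have hx : ∀ x ∉ E, (g : Equiv.Perm V) b ∈ (g • x).side B := fun x hx =>
      key x fun h => hx (hE' z x _ hz h hzE)
    rcases hP with hP | hP
    · exact .inr (.inr (.inr fun x h => hP _ (hx x h)))
    · exact .inr (.inr (.inl fun x h => hP _ (hx x h)))
  · push Not at hD
    rcases hP with hP | hP
    · exact .inr (.inl fun x h => hP _ (key x (hD x h)))
    · exact .inl fun x h => hP _ (key x (hD x h))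

lemma exists_accumulation [FiniteNeighbors X] (hX : X.Connected) [NoncompactSpace Γ]
    (hΓ : IsClosed (Γ : Set (Equiv.Perm V))) (b : V) : ∃ x : Boundary X, ∀ (K : Finset V)
      (S : Set Γ), IsCompact S → ∃ g ∉ S, (g : Equiv.Perm V) b ∈ x.side K := by
  have hU : ∀ K : Finset V, ∀ᶠ g : Γ in (Ultrafilter.of (cocompact Γ) : Filter Γ),
      (g : Equiv.Perm V) b ∉ K := by
    intro K
    refine Ultrafilter.of_le _ ?_
    filter_upwards [(isCompact_meets hX hΓ {b} K).compl_mem_cocompact] with g hg h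
    exact hg ⟨b, Finset.mem_singleton_self b, h⟩
  have hC : ∀ K : Finset V, ∃ C : X.ComponentCompl (K : Set V),
      ∀ᶠ g : Γ in (Ultrafilter.of (cocompact Γ) : Filter Γ), (g : Equiv.Perm V) b ∈ C.supp := by
    intro K
    have := finite_componentCompl hX K
    have h : ∀ᶠ g : Γ in (Ultrafilter.of (cocompact Γ) : Filter Γ),
        ∃ C : X.ComponentCompl (K : Set V), (g : Equiv.Perm V) b ∈ C.supp :=
      (hU K).mono fun g hg => ⟨_, X.componentComplMk_mem hg⟩
    exact Ultrafilter.eventually_exists_iff.1 h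
  choose C hC using hC
  refine ⟨ofComp C fun K L _ => ?_, fun K S hS => ?_⟩
  · obtain ⟨g, h1, h2⟩ := ((hC L).and (hC K)).exists
    exact ⟨_, h1, h2⟩
  · have h := Ultrafilter.of_le (cocompact Γ) hS.compl_mem_cocompact
    obtain ⟨g, h1, h2⟩ := ((hC K).and h).exists
    exact ⟨g, h2, h1⟩

lemma accumulates_everywhere [FiniteNeighbors X] (hX : X.Connected) [NoncompactSpace Γ]
    (hΓ : IsClosed (Γ : Set (Equiv.Perm V))) [MulAction.IsPretransitive Γ (Boundary X)] (b : V)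
    (x : Boundary X) (K : Finset V) (S : Set Γ) (hS : IsCompact S) :
    ∃ g ∉ S, (g : Equiv.Perm V) b ∈ x.side K := by
  obtain ⟨x₀, h⟩ := exists_accumulation hX hΓ b
  obtain ⟨k, rfl⟩ := MulAction.exists_smul_eq Γ x₀ x
  obtain ⟨g, hg, hg'⟩ := h (K.image (k : Equiv.Perm V).symm) ((fun g => k⁻¹ * g) '' S)
    (hS.image (continuous_const_mul _))
  exact ⟨k * g, fun hk => hg ⟨_, hk, by simp⟩, apply_mem_side_smul k hg'⟩

lemma exists_contraction [FiniteNeighbors X] (hX : X.Connected) [NoncompactSpace Γ]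
    (hΓ : IsClosed (Γ : Set (Equiv.Perm V))) [MulAction.IsPretransitive Γ (Boundary X)]
    [Infinite (Boundary X)] : ∃ (h : Γ) (E : Set (Boundary X)) (e : Boundary X), IsClopen E ∧
      (∀ x ∈ E, h • x ∈ E) ∧ e ∈ E ∧ h⁻¹ • e ∉ E := by
  obtain ⟨x₁⟩ := (inferInstance : Nonempty (Boundary X))
  obtain ⟨x₂, h12⟩ := exists_ne x₁
  obtain ⟨x₃, h3⟩ := (Set.toFinite {x₁, x₂}).exists_notMem
  simp only [Set.mem_insert_iff, Set.mem_singleton_iff, not_or] at h3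
  obtain ⟨K₁, hK₁⟩ := exists_side_ne h12
  obtain ⟨K₂, hK₂⟩ := exists_side_ne h3.1
  obtain ⟨K₃, hK₃⟩ := exists_side_ne h3.2
  obtain ⟨b⟩ := hX.nonempty
  obtain ⟨B, hKB, hB⟩ := SimpleGraph.extend_finset_to_connected hX.preconnected
    (t := insert b (K₁ ∪ K₂ ∪ K₃)) (Finset.insert_nonempty _ _)
  have hb : b ∈ B := hKB (Finset.mem_insert_self _ _)
  have h21 : x₂.side B ≠ x₁.side B := fun h => hK₁ (side_eq_of_subset (fun v hv => hKB (by simp [hv])) h)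
  have h31 : x₃.side B ≠ x₁.side B := fun h => hK₂ (side_eq_of_subset (fun v hv => hKB (by simp [hv])) h)
  have h32 : x₃.side B ≠ x₂.side B := fun h => hK₃ (side_eq_of_subset (fun v hv => hKB (by simp [hv])) h)
  have main : ∀ x : Boundary X, ∃ g : Γ, ∀ z : Boundary X,
      (g : Equiv.Perm V).symm b ∉ z.side B → (g • z).side B = x.side B := by
    intro x
    obtain ⟨g, hg, hgx⟩ := accumulates_everywhere hX hΓ b x B _ (isCompact_meets hX hΓ B B)
    refine ⟨g, fun z hz => side_eq_of_mem (apply_mem_side_smul_of_disjoint hX hB.preconnected hb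
      (fun a ha h => hg ⟨a, ha, h⟩) hz) hgx⟩
  obtain ⟨g₁, hg₁⟩ := main x₁
  obtain ⟨g₂, hg₂⟩ := main x₂
  by_cases c₁ : (g₁ : Equiv.Perm V).symm b ∈ x₁.side B
  · have d₁ : ∀ z : Boundary X, z.side B ≠ x₁.side B → (g₁ • z).side B = x₁.side B :=
      fun z hz => hg₁ z fun h => hz (side_eq_of_mem h c₁)
    by_cases c₂ : (g₂ : Equiv.Perm V).symm b ∈ x₂.side B
    · have d₂ : ∀ z : Boundary X, z.side B ≠ x₂.side B → (g₂ • z).side B = x₂.side B :=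
        fun z hz => hg₂ z fun h => hz (side_eq_of_mem h c₂)
      refine ⟨g₂ * g₁, {x | x.side B = x₂.side B}, (g₂ * g₁) • x₃, isClopen_side_eq _ _, ?_, ?_, ?_⟩
      · intro x (hx : _ = _)
        change ((g₂ * g₁) • x).side B = _
        rw [mul_smul]
        exact d₂ _ (by rw [d₁ x (hx ▸ h21)]; exact h21.symm)
      · change ((g₂ * g₁) • x₃).side B = _
        rw [mul_smul]
        exact d₂ _ (by rw [d₁ x₃ h31]; exact h21.symm)
      · rw [inv_smul_smul]
        exact h32
    · have : ∃ z : Boundary X, (g₂ : Equiv.Perm V).symm b ∉ z.side B ∧ z.side B ≠ x₂.side B := by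
        by_cases h : (g₂ : Equiv.Perm V).symm b ∈ x₁.side B
        · exact ⟨x₃, fun h' => h31 (side_eq_of_mem h' h), h32⟩
        · exact ⟨x₁, h, h21.symm⟩
      obtain ⟨z, hz, hz'⟩ := this
      refine ⟨g₂, {x | x.side B = x₂.side B}, g₂ • z, isClopen_side_eq _ _, ?_, hg₂ z hz, ?_⟩
      · intro x (hx : _ = _)
        exact hg₂ x (hx ▸ c₂)
      · rw [inv_smul_smul]
        exact hz'
  · have : ∃ z : Boundary X, (g₁ : Equiv.Perm V).symm b ∉ z.side B ∧ z.side B ≠ x₁.side B := by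
      by_cases h : (g₁ : Equiv.Perm V).symm b ∈ x₂.side B
      · exact ⟨x₃, fun h' => h32 (side_eq_of_mem h' h), h31⟩
      · exact ⟨x₂, h, h21⟩
    obtain ⟨z, hz, hz'⟩ := this
    refine ⟨g₁, {x | x.side B = x₁.side B}, g₁ • z, isClopen_side_eq _ _, ?_, hg₁ z hz, ?_⟩
    · intro x (hx : _ = _)
      exact hg₁ x (hx ▸ c₁)
    · rw [inv_smul_smul]
      exact hz'

end Boundary

end EndDynamics

/-- **Theorem B(i).** Let `X` be a connected locally finite graph with infinitely many ends
and let `Γ ≤ Aut(X)` be closed (in the permutation topology), non-compact and transitive on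
the space of ends of `X`. Then `Γ` (a totally disconnected locally compact group, equipped
with a left Haar measure `μ`) is not a Wiener group. -/
theorem boundary_transitive_graph_group_not_wiener
    {V : Type} [DecidableEq V] (X : SimpleGraph V)
    (hconn : X.Connected)
    (hlf : ∀ v : V, (X.neighborSet v).Finite)
    (hends : X.end.Infinite)
    (Γ : Subgroup (Equiv.Perm V))
    (haut : ∀ φ ∈ Γ, ∀ u v : V, X.Adj (φ u) (φ v) ↔ X.Adj u v)
    (hclosed : IsClosed (Γ : Set (Equiv.Perm V)))
    (hnoncompact : ¬ IsCompact (Γ : Set (Equiv.Perm V)))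
    (htrans : ∀ s ∈ X.end, ∀ t ∈ X.end, ∃ φ ∈ Γ, EndMapsTo X φ s t)
    [MeasurableSpace ↥Γ] [BorelSpace ↥Γ]
    (μ : MeasureTheory.Measure ↥Γ) [μ.IsHaarMeasure] :
    ¬ IsWienerGroup μ := by
  have : ActsByAut X Γ := ⟨haut⟩
  have : FiniteNeighbors X := ⟨hlf⟩
  have : Countable V := countable_of_connected hconn
  have : LocallyCompactSpace Γ := locallyCompactSpace hconn hclosed
  have : SecondCountableTopology Γ := Topology.IsEmbedding.subtypeVal.secondCountableTopology
  have : CompactSpace (Boundary X) := Boundary.compactSpace hconn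
  have : Infinite (Boundary X) := hends.to_subtype
  have : NoncompactSpace Γ := not_compactSpace_iff.1 fun h =>
    hnoncompact (isCompact_iff_compactSpace.2 h)
  have : MulAction.IsPretransitive Γ (Boundary X) := ⟨fun x y => by
    obtain ⟨φ, hφ, h⟩ := htrans x.1 x.2 y.1 y.2
    exact ⟨⟨φ, hφ⟩, Boundary.smul_eq_of_endMapsTo ⟨φ, hφ⟩ x y h⟩⟩
  obtain ⟨h, E, e, hE, hEE, he, he'⟩ := Boundary.exists_contraction (X := X) hconn hclosed
  exact not_isWienerGroup_of_dynamics (hasCompactOpenBasis hconn hclosed)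
    (Boundary.hasNorthSouth hconn hclosed) hE hEE he he'

end GraphWiener
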